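/- arXiv:2402.06834 — 2 statements merged into one kernel-verified Lean document; each statement's English description precedes it below -/
import Mathlib

section
/- Let f:(R,m) → (S,n) be a surjective local homomorphism of noetherian local rings such that the flat dimension of S as an R-module is finite. If f is not an isomorphism, then the kernel of f contains an element that is a non-zerodivisor (regular element) on R. -/
/- ## Preliminary definitions -/

universe u

open IsLocalRing

noncomputable section

/-- The embedding dimension of a local ring: `dim_k (m/m²)`. -/
def embDim (R : Type u) [CommRing R] [IsLocalRing R] : ℕ :=
  Module.finrank (ResidueField R) (CotangentSpace R)

/-- Witness that `Q` is a Gorenstein flat `R`-module: a two-sided exact complex `F` of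
flat modules, which stays exact after applying `I ⊗ᵣ -` for every injective module `I`,
with `Q` isomorphic to the image of the differential `F₁ → F₀`. -/
structure GorensteinFlatWitness (R : Type u) [CommRing R] (Q : Type u) [AddCommGroup Q]
    [Module R Q] where
  F : ℤ → Type u
  [instAdd : ∀ i, AddCommGroup (F i)]
  [instMod : ∀ i, Module R (F i)]
  d : (i : ℤ) → F (i + 1) →ₗ[R] F i
  flat : ∀ i, Module.Flat R (F i)
  exact : ∀ i : ℤ, Function.Exact (d (i + 1)) (d i)
  exact_tensor : ∀ (I : Type u) [AddCommGroup I] [Module R I], Module.Injective R I →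
    ∀ i : ℤ, Function.Exact (LinearMap.lTensor I (d (i + 1))) (LinearMap.lTensor I (d i))
  iso : Nonempty (Q ≃ₗ[R] LinearMap.range (d 0))

/-- `Q` is a Gorenstein flat `R`-module. -/
def IsGorensteinFlat (R : Type u) [CommRing R] (Q : Type u) [AddCommGroup Q]
    [Module R Q] : Prop :=
  Nonempty (GorensteinFlatWitness R Q)

/-- Witness that `J` is a Gorenstein injective `R`-module: a two-sided exact complex `I` of
injective modules, which stays exact after applying `Hom_R(E, -)` for every injective module
`E`, with `J` isomorphic to the image of the differential `I₁ → I₀`. -/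
structure GorensteinInjectiveWitness (R : Type u) [CommRing R] (J : Type u) [AddCommGroup J]
    [Module R J] where
  I : ℤ → Type u
  [instAdd : ∀ i, AddCommGroup (I i)]
  [instMod : ∀ i, Module R (I i)]
  d : (i : ℤ) → I (i + 1) →ₗ[R] I i
  injective : ∀ i, Module.Injective R (I i)
  exact : ∀ i : ℤ, Function.Exact (d (i + 1)) (d i)
  exact_hom : ∀ (E : Type u) [AddCommGroup E] [Module R E], Module.Injective R E →
    ∀ i : ℤ, Function.Exact (LinearMap.llcomp (σ₁₂ := RingHom.id R) (σ₁₃ := RingHom.id R)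
        R E (I (i + 1 + 1)) (I (i + 1)) (d (i + 1)))
      (LinearMap.llcomp (σ₁₂ := RingHom.id R) (σ₁₃ := RingHom.id R) R E (I (i + 1)) (I i) (d i))
  iso : Nonempty (J ≃ₗ[R] LinearMap.range (d 0))

/-- `J` is a Gorenstein injective `R`-module. -/
def IsGorensteinInjective (R : Type u) [CommRing R] (J : Type u) [AddCommGroup J]
    [Module R J] : Prop :=
  Nonempty (GorensteinInjectiveWitness R J)

/-- A surjection onto `M` whose source is Gorenstein flat. -/
structure GorensteinFlatCover (R : Type u) [CommRing R] (M : Type u) [AddCommGroup M]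
    [Module R M] where
  Q : Type u
  [instAdd : AddCommGroup Q]
  [instMod : Module R Q]
  π : Q →ₗ[R] M
  gflat : IsGorensteinFlat R Q
  surj : Function.Surjective π

attribute [instance] GorensteinFlatCover.instAdd GorensteinFlatCover.instMod

/-- `M` admits an exact sequence `0 → Qₙ → ⋯ → Q₀ → M → 0` with all `Qᵢ` Gorenstein flat;
equivalently (by splicing), defined by recursion on `n`. -/
def gfdLE (R : Type u) [CommRing R] :
    (n : ℕ) → (M : Type u) → [AddCommGroup M] → [Module R M] → Prop
  | 0, M, _, _ => IsGorensteinFlat R M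
  | n + 1, M, _, _ => ∃ c : GorensteinFlatCover R M, gfdLE R n (LinearMap.ker c.π)

/-- The Gorenstein flat dimension of `M` over `R`, as an element of `ℕ∞`
(the zero module has Gorenstein flat dimension `0` here, and `⊤` means infinite). -/
def gfd (R : Type u) [CommRing R] (M : Type u) [AddCommGroup M] [Module R M] : ℕ∞ :=
  sInf ((↑) '' { n : ℕ | gfdLE R n M })

/-- A flat cover of `M`. -/
structure FlatCover (R : Type u) [CommRing R] (M : Type u) [AddCommGroup M]
    [Module R M] where
  Q : Type u
  [instAdd : AddCommGroup Q]
  [instMod : Module R Q]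
  π : Q →ₗ[R] M
  flat : Module.Flat R Q
  surj : Function.Surjective π

attribute [instance] FlatCover.instAdd FlatCover.instMod

/-- `M` admits a flat resolution of length `≤ n`. -/
def fdLE (R : Type u) [CommRing R] :
    (n : ℕ) → (M : Type u) → [AddCommGroup M] → [Module R M] → Prop
  | 0, M, _, _ => Module.Flat R M
  | n + 1, M, _, _ => ∃ c : FlatCover R M, fdLE R n (LinearMap.ker c.π)

/-- The flat dimension of `M` over `R`, as an element of `ℕ∞`. -/
def flatDim (R : Type u) [CommRing R] (M : Type u) [AddCommGroup M] [Module R M] : ℕ∞ :=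
  sInf ((↑) '' { n : ℕ | fdLE R n M })

/-- An embedding of `M` into a Gorenstein injective module. -/
structure GorensteinInjectiveHull (R : Type u) [CommRing R] (M : Type u) [AddCommGroup M]
    [Module R M] where
  J : Type u
  [instAdd : AddCommGroup J]
  [instMod : Module R J]
  ι : M →ₗ[R] J
  ginj : IsGorensteinInjective R J
  inj : Function.Injective ι

attribute [instance] GorensteinInjectiveHull.instAdd GorensteinInjectiveHull.instMod

/-- `M` admits an exact sequence `0 → M → J₀ → ⋯ → J₋ₙ → 0` with all `Jᵢ`
Gorenstein injective. -/
def gidLE (R : Type u) [CommRing R] :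
    (n : ℕ) → (M : Type u) → [AddCommGroup M] → [Module R M] → Prop
  | 0, M, _, _ => IsGorensteinInjective R M
  | n + 1, M, _, _ => ∃ c : GorensteinInjectiveHull R M,
      gidLE R n (c.J ⧸ LinearMap.range c.ι)

/-- The Gorenstein injective dimension of `M` over `R`, as an element of `ℕ∞`. -/
def gid (R : Type u) [CommRing R] (M : Type u) [AddCommGroup M] [Module R M] : ℕ∞ :=
  sInf ((↑) '' { n : ℕ | gidLE R n M })

/-- An embedding of `M` into an injective module. -/
structure InjectiveHullStep (R : Type u) [CommRing R] (M : Type u) [AddCommGroup M]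
    [Module R M] where
  J : Type u
  [instAdd : AddCommGroup J]
  [instMod : Module R J]
  ι : M →ₗ[R] J
  injective : Module.Injective R J
  inj : Function.Injective ι

attribute [instance] InjectiveHullStep.instAdd InjectiveHullStep.instMod

/-- `M` admits an injective resolution of length `≤ n`. -/
def idLE (R : Type u) [CommRing R] :
    (n : ℕ) → (M : Type u) → [AddCommGroup M] → [Module R M] → Prop
  | 0, M, _, _ => Module.Injective R M
  | n + 1, M, _, _ => ∃ c : InjectiveHullStep R M, idLE R n (c.J ⧸ LinearMap.range c.ι)

/-- The injective dimension of `M` over `R`, as an element of `ℕ∞`. -/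
def injDim (R : Type u) [CommRing R] (M : Type u) [AddCommGroup M] [Module R M] : ℕ∞ :=
  sInf ((↑) '' { n : ℕ | idLE R n M })

/-- The `i`-th Ext module `Ext_R^i(N, M)`. -/
def extModule (R : Type u) [CommRing R] (i : ℕ) (N M : Type u) [AddCommGroup N] [Module R N]
    [AddCommGroup M] [Module R M] : ModuleCat.{u} R :=
  ((Ext R (ModuleCat.{u} R) i).obj (Opposite.op (ModuleCat.of R N))).obj (ModuleCat.of R M)

/-- The depth of `M` with respect to the ideal `I`: the least `i` such that
`Ext_R^i(R/I, M) ≠ 0` (with value `⊤ : ℕ∞` if no such `i` exists). -/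
def idealDepth (R : Type u) [CommRing R] (I : Ideal R) (M : Type u) [AddCommGroup M]
    [Module R M] : ℕ∞ :=
  sInf ((↑) '' { i : ℕ | ¬ Subsingleton (extModule R i (R ⧸ I) M) })

/-- A finitely generated `S`-module `M` is totally reflexive if the biduality map
`M → Hom_S(Hom_S(M,S),S)` is bijective and `Ext_S^i(M,S) = 0 = Ext_S^i(M^*,S)`
for all `i ≥ 1`. -/
def IsTotallyReflexive (S : Type u) [CommRing S] (M : Type u) [AddCommGroup M]
    [Module S M] : Prop :=
  Module.Finite S M ∧ Function.Bijective (Module.Dual.eval S M) ∧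
    ∀ i : ℕ, 1 ≤ i → Subsingleton (extModule S i M S) ∧
      Subsingleton (extModule S i (Module.Dual S M) S)

/-- A noetherian local ring is G-regular if every totally reflexive module is free. -/
def IsGRegular (S : Type u) [CommRing S] : Prop :=
  ∀ (M : Type u) [AddCommGroup M] [Module S M], IsTotallyReflexive S M → Module.Free S M

/-- A commutative ring is a regular local ring if it is a noetherian local ring whose
maximal ideal is generated by a regular sequence. -/
def IsRegularLocal (A : Type u) [CommRing A] : Prop :=
  IsNoetherianRing A ∧ ∃ h : IsLocalRing A, ∃ rs : List A,
    RingTheory.Sequence.IsRegular A rs ∧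
      Ideal.span { x | x ∈ rs } = @IsLocalRing.maximalIdeal A _ h

/-- A Gorenstein local ring: a noetherian local ring of finite self-injective dimension. -/
def IsGorensteinLocal (A : Type u) [CommRing A] : Prop :=
  IsNoetherianRing A ∧ IsLocalRing A ∧ injDim A A < ⊤

/-- `E` is an injective envelope (injective hull) of the residue field of the local
ring `S`: an injective module containing the residue field as an essential submodule. -/
def IsInjEnvResidueField (S : Type u) [CommRing S] [IsLocalRing S] (E : Type u)
    [AddCommGroup E] [Module S E] : Prop :=
  Module.Injective S E ∧ ∃ ι : ResidueField S →ₗ[S] E, Function.Injective ι ∧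
    ∀ N : Submodule S E, N ≠ ⊥ → N ⊓ LinearMap.range ι ≠ ⊥

end
/- ## Homological dimensions along a ring homomorphism -/

noncomputable section

variable {R S : Type u} [CommRing R] [CommRing S]

/-- The flat dimension `fd_R S` of `S` as an `R`-module along `f : R → S`. -/
def flatDimAlong (f : R →+* S) : ℕ∞ :=
  letI := f.toModule; flatDim R S

/-- The Gorenstein flat dimension over `R` of an `S`-module `M`, viewed as an
`R`-module along `f : R → S`. -/
def gfdAlong (f : R →+* S) (M : Type u) [AddCommGroup M] [Module S M] : ℕ∞ :=
  letI := Module.compHom M f; gfd R M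

/-- The Gorenstein injective dimension over `R` of an `S`-module `M`, viewed as an
`R`-module along `f : R → S`. -/
def gidAlong (f : R →+* S) (M : Type u) [AddCommGroup M] [Module S M] : ℕ∞ :=
  letI := Module.compHom M f; gid R M

/-- `M` is Gorenstein flat as an `R`-module along `f : R → S`. -/
def IsGorensteinFlatAlong (f : R →+* S) (M : Type u) [AddCommGroup M] [Module S M] : Prop :=
  letI := Module.compHom M f; IsGorensteinFlat R M

/-- `M` is Gorenstein injective as an `R`-module along `f : R → S`. -/
def IsGorensteinInjectiveAlong (f : R →+* S) (M : Type u) [AddCommGroup M]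
    [Module S M] : Prop :=
  letI := Module.compHom M f; IsGorensteinInjective R M

end

open scoped TensorProduct

theorem Module.Flat.of_exact_of_flat {R K P Q : Type*} [CommRing R] [AddCommGroup K] [Module R K]
    [AddCommGroup P] [Module R P] [AddCommGroup Q] [Module R Q] [Module.Flat R P] [Module.Flat R Q]
    {i : K →ₗ[R] P} {π : P →ₗ[R] Q} (hi : Function.Injective i) (hπ : Function.Surjective π)
    (h : Function.Exact i π) : Module.Flat R K := by
  rw [Module.Flat.iff_rTensor_injectiveₛ]
  intro A _ _ N
  let : AddCommGroup A := Module.addCommMonoidToAddCommGroup R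
  have hN := LinearMap.lTensor_injective_of_exact_of_flat π hπ i hi h N
  have hP := Module.Flat.rTensor_preserves_injective_linearMap (M := P) N.subtype
    N.subtype_injective
  have hcomp : Function.Injective (i.lTensor A ∘ₗ N.subtype.rTensor K) := by
    rw [LinearMap.lTensor_comp_rTensor, ← LinearMap.rTensor_comp_lTensor, LinearMap.coe_comp]
    exact hP.comp hN
  rw [LinearMap.coe_comp] at hcomp
  exact hcomp.of_comp

theorem Module.Flat.prod {R : Type*} {L F : Type u} [CommRing R] [AddCommGroup L] [Module R L]
    [AddCommGroup F] [Module R F] [Module.Flat R L] [Module.Flat R F] :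
    Module.Flat R (L × F) := by
  rw [Module.Flat.iff_rTensor_injectiveₛ]
  intro A _ _ N
  let : AddCommGroup A := Module.addCommMonoidToAddCommGroup R
  rw [injective_iff_map_eq_zero]
  intro x hx
  have hvanish : ∀ {G : Type u} [AddCommGroup G] [Module R G] [Module.Flat R G]
      (g : L × F →ₗ[R] G), g.lTensor N x = 0 := by
    intro G _ _ _ g
    apply Module.Flat.rTensor_preserves_injective_linearMap (M := G) N.subtype
      N.subtype_injective
    rw [← LinearMap.comp_apply, LinearMap.rTensor_comp_lTensor, ← LinearMap.lTensor_comp_rTensor,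
      LinearMap.comp_apply, hx, map_zero, map_zero]
  have hid : LinearMap.inl R L F ∘ₗ LinearMap.fst R L F +
      LinearMap.inr R L F ∘ₗ LinearMap.snd R L F = LinearMap.id := by
    ext <;> simp
  rw [← LinearMap.id_apply (R := R) x, ← LinearMap.lTensor_id, ← hid, LinearMap.lTensor_add,
    LinearMap.add_apply, LinearMap.lTensor_comp, LinearMap.lTensor_comp, LinearMap.comp_apply,
    LinearMap.comp_apply, hvanish, hvanish, map_zero, map_zero, add_zero]

/-- If `0 → K → P → Q → 0` is exact with `Q` flat, then the flat dimension of `K` is at most that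
of `P`. -/
theorem fdLE.of_exact {R : Type u} [CommRing R] {n : ℕ} {K P Q : Type u} [AddCommGroup K]
    [Module R K] [AddCommGroup P] [Module R P] [AddCommGroup Q] [Module R Q] [Module.Flat R Q]
    {i : K →ₗ[R] P} {π : P →ₗ[R] Q} (hi : Function.Injective i) (hπ : Function.Surjective π)
    (h : Function.Exact i π) (hP : fdLE R n P) : fdLE R n K := by
  induction n generalizing K P Q with
  | zero =>
    have : Module.Flat R P := hP
    exact Module.Flat.of_exact_of_flat hi hπ h
  | succ n ih =>
    obtain ⟨c, hc⟩ := hP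
    have := c.flat
    have hflat : Module.Flat R (LinearMap.ker (π ∘ₗ c.π)) :=
      Module.Flat.of_exact_of_flat (Submodule.subtype_injective _) (hπ.comp c.surj)
        (LinearMap.exact_subtype_ker_map _)
    let e : K ≃ₗ[R] LinearMap.ker π :=
      (LinearEquiv.ofInjective i hi).trans (LinearEquiv.ofEq _ _ h.linearMap_ker_eq.symm)
    let g : LinearMap.ker (π ∘ₗ c.π) →ₗ[R] LinearMap.ker π :=
      c.π.restrict fun x hx ↦ by simpa using hx
    have hg : Function.Surjective g := by
      rintro ⟨y, hy⟩
      obtain ⟨x, rfl⟩ := c.surj y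
      exact ⟨⟨x, by simpa using hy⟩, rfl⟩
    refine ⟨⟨_, e.symm.toLinearMap ∘ₗ g, hflat, e.symm.surjective.comp hg⟩, ?_⟩
    have hker : ∀ x : LinearMap.ker (e.symm.toLinearMap ∘ₗ g), c.π x.1.1 = 0 := by
      rintro ⟨x, hx⟩
      have : g x = 0 := by simpa using hx
      exact congrArg Subtype.val this
    let j : LinearMap.ker (e.symm.toLinearMap ∘ₗ g) →ₗ[R] LinearMap.ker c.π :=
      LinearMap.codRestrict _ (Submodule.subtype _ ∘ₗ Submodule.subtype _) hker
    refine ih (Q := PUnit) (i := j) (π := 0) ?_ (fun _ ↦ ⟨0, rfl⟩) ?_ hc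
    · intro x y hxy
      exact Subtype.ext (Subtype.ext (congrArg (fun z ↦ z.1) hxy))
    · rintro ⟨y, hy⟩
      have hy' : c.π y = 0 := hy
      refine ⟨fun _ ↦ ⟨⟨⟨y, by simp [hy']⟩, ?_⟩, rfl⟩, fun _ ↦ rfl⟩
      have : g ⟨y, by simp [hy']⟩ = 0 := Subtype.ext hy'
      simp [this]

theorem fdLE.prod_flat {R : Type u} [CommRing R] {n : ℕ} {L F : Type u} [AddCommGroup L]
    [Module R L] [AddCommGroup F] [Module R F] [Module.Flat R F] (hL : fdLE R n L) :
    fdLE R n (L × F) := by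
  cases n with
  | zero =>
    have : Module.Flat R L := hL
    exact Module.Flat.prod
  | succ n =>
    obtain ⟨c, hc⟩ := hL
    have := c.flat
    refine ⟨⟨c.Q × F, c.π.prodMap LinearMap.id, Module.Flat.prod, ?_⟩, ?_⟩
    · exact c.surj.prodMap Function.surjective_id
    · have hker : ∀ x : LinearMap.ker (c.π.prodMap (LinearMap.id : F →ₗ[R] F)),
          c.π x.1.1 = 0 := fun x ↦ congrArg Prod.fst x.2
      refine fdLE.of_exact (Q := PUnit) (π := 0)
        (i := LinearMap.codRestrict _ (LinearMap.fst R c.Q F ∘ₗ Submodule.subtype _) hker)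
        ?_ (fun _ ↦ ⟨0, rfl⟩) ?_ hc
      · intro x y hxy
        have hx : x.1.2 = 0 := congrArg Prod.snd x.2
        have hy : y.1.2 = 0 := congrArg Prod.snd y.2
        exact Subtype.ext (Prod.ext (congrArg Subtype.val hxy) (hx.trans hy.symm))
      · rintro ⟨y, hy⟩
        have hy' : c.π y = 0 := hy
        exact ⟨fun _ ↦ ⟨⟨(y, 0), by simp [hy']⟩, rfl⟩, fun _ ↦ rfl⟩

theorem fdLE.ker_of_projective {R : Type u} [CommRing R] {n : ℕ} {M F : Type u} [AddCommGroup M]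
    [Module R M] [AddCommGroup F] [Module R F] [Module.Projective R F] {φ : F →ₗ[R] M}
    (hφ : Function.Surjective φ) (hM : fdLE R (n + 1) M) : fdLE R n (LinearMap.ker φ) := by
  obtain ⟨c, hc⟩ := hM
  have := c.flat
  obtain ⟨h, hh⟩ := Module.projective_lifting_property c.π φ c.surj
  have hh' : ∀ x, c.π (h x) = φ x := fun x ↦ LinearMap.congr_fun hh x
  let k : LinearMap.ker φ →ₗ[R] LinearMap.ker c.π := h.restrict fun x hx ↦ by
    simpa [hh'] using hx
  refine fdLE.of_exact (i := (-k).prod (Submodule.subtype _))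
    (π := (Submodule.subtype _).coprod h) ?_ ?_ ?_ (hc.prod_flat (F := F))
  · intro x y hxy
    exact Subtype.ext (congrArg Prod.snd hxy)
  · intro q
    obtain ⟨x, hx⟩ := hφ (c.π q)
    exact ⟨(⟨q - h x, by simp [hh', hx]⟩, x), by simp⟩
  · rintro ⟨⟨l, hl⟩, x⟩
    have hl' : c.π l = 0 := hl
    constructor
    · intro hx
      have hx' : l + h x = 0 := hx
      refine ⟨⟨x, ?_⟩, Prod.ext (Subtype.ext ?_) rfl⟩
      · have := congrArg c.π hx'
        simpa [hl', hh'] using this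
      · exact (eq_neg_of_add_eq_zero_left hx').symm
    · rintro ⟨y, hy⟩
      have h1 : -h y.1 = l := congrArg (fun z ↦ z.1.1) hy
      have h2 : y.1 = x := congrArg Prod.snd hy
      subst h1 h2
      simp

/-- Over a local ring whose maximal ideal is the annihilator of an element, the cokernel of an
injective map of finite free modules is free. -/
theorem IsLocalRing.free_and_finrank_of_exact {A K F M : Type*} [CommRing A] [IsLocalRing A]
    [AddCommGroup K] [Module A K] [AddCommGroup F] [Module A F] [AddCommGroup M] [Module A M]
    [Module.Free A K] [Module.Finite A K] [Module.Free A F] [Module.Finite A F]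
    {s : ResidueField A →ₗ[A] A} (hs : Function.Injective s)
    {i : K →ₗ[A] F} {π : F →ₗ[A] M} (hi : Function.Injective i) (hπ : Function.Surjective π)
    (h : Function.Exact i π) :
    Module.Free A M ∧ Module.finrank A F = Module.finrank A K + Module.finrank A M := by
  have hinj : Function.Injective (i.lTensor (ResidueField A)) := by
    have hcomp : Function.Injective (s.rTensor F ∘ₗ i.lTensor (ResidueField A)) := by
      rw [LinearMap.rTensor_comp_lTensor, ← LinearMap.lTensor_comp_rTensor, LinearMap.coe_comp]
      exact (Module.Flat.lTensor_preserves_injective_linearMap i hi).comp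
        (Module.Flat.rTensor_preserves_injective_linearMap s hs)
    rw [LinearMap.coe_comp] at hcomp
    exact hcomp.of_comp
  have hfree : Module.Free A M := Module.free_of_lTensor_residueField_injective i π hπ h hinj
  have : Module.Finite A M := Module.Finite.of_surjective π hπ
  obtain ⟨l, hl⟩ := Module.projective_lifting_property π LinearMap.id hπ
  obtain ⟨e, -⟩ := h.splitSurjectiveEquiv hi ⟨l, hl⟩
  exact ⟨hfree, by rw [e.finrank_eq, Module.finrank_prod]⟩

theorem exists_injective_residueField_localization {R : Type*} [CommRing R] [IsNoetherianRing R]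
    {q : Ideal R} [q.IsPrime] (hq : q ∈ associatedPrimes R R) :
    ∃ s : ResidueField (Localization.AtPrime q) →ₗ[Localization.AtPrime q]
      Localization.AtPrime q, Function.Injective s := by
  have h : maximalIdeal (Localization.AtPrime q) ∈
      associatedPrimes (Localization.AtPrime q) (Localization.AtPrime q) := by
    refine
      Module.associatedPrimes.mem_associatedPrimes_of_comap_mem_associatedPrimes_of_isLocalizedModule
        q.primeCompl (Algebra.linearMap R (Localization.AtPrime q)) _ ?_
    convert hq
    exact Localization.AtPrime.under_maximalIdeal
  exact ((isAssociatedPrime_iff_exists_injective_linearMap _ _).1 h).2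

/-- A finite module of finite flat dimension over a noetherian local ring has a well-defined rank at
the associated primes of the ring. -/
theorem fdLE.exists_rank {R : Type u} [CommRing R] [IsLocalRing R] [IsNoetherianRing R] {n : ℕ}
    {M : Type u} [AddCommGroup M] [Module R M] [Module.Finite R M] (hM : fdLE R n M) :
    ∃ r : ℕ, ∀ (q : Ideal R) [q.IsPrime], q ∈ associatedPrimes R R →
      Module.Free (Localization.AtPrime q) (Localization.AtPrime q ⊗[R] M) ∧
      Module.finrank (Localization.AtPrime q) (Localization.AtPrime q ⊗[R] M) = r := by
  induction n generalizing M with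
  | zero =>
    have : Module.Flat R M := hM
    have : Module.Free R M := Module.free_of_flat_of_isLocalRing
    exact ⟨Module.finrank R M, fun q _ _ ↦ ⟨inferInstance, Module.finrank_baseChange⟩⟩
  | succ n ih =>
    obtain ⟨m, φ, hφ⟩ := Module.Finite.exists_fin' R M
    obtain ⟨r, hr⟩ := ih (hM.ker_of_projective hφ)
    refine ⟨m - r, fun q _ hq ↦ ?_⟩
    obtain ⟨hfree, hrank⟩ := hr q hq
    obtain ⟨s, hs⟩ := exists_injective_residueField_localization hq
    have hexact := LinearMap.exact_subtype_ker_map φ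
    obtain ⟨h₁, h₂⟩ := IsLocalRing.free_and_finrank_of_exact hs
      (i := (LinearMap.ker φ).subtype.baseChange (Localization.AtPrime q))
      (π := φ.baseChange (Localization.AtPrime q))
      (Module.Flat.lTensor_preserves_injective_linearMap _ (Submodule.subtype_injective _))
      (LinearMap.lTensor_surjective _ hφ) (lTensor_exact _ hexact hφ)
    rw [Module.finrank_baseChange, Module.finrank_fin_fun] at h₂
    exact ⟨h₁, by omega⟩

/-- The annihilator of a finite module of finite flat dimension over a noetherian local ring is
either zero or contains a regular element. -/
theorem fdLE.exists_mem_annihilator_mem_nonZeroDivisors {R : Type u} [CommRing R] [IsLocalRing R]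
    [IsNoetherianRing R] {n : ℕ} {M : Type u} [AddCommGroup M] [Module R M] [Module.Finite R M]
    (hM : fdLE R n M) (hne : Module.annihilator R M ≠ ⊥) :
    ∃ a ∈ Module.annihilator R M, a ∈ nonZeroDivisors R := by
  by_contra! hcon
  obtain ⟨r, hr⟩ := hM.exists_rank
  obtain ⟨p, hp, hle⟩ : ∃ p ∈ associatedPrimes R R, Module.annihilator R M ≤ p :=
    (Ideal.subset_union_prime_finite (associatedPrimes.finite R R) (f := id) 0 0
      fun _ h _ _ ↦ h.1).1 <| by
        simp_rw [id, biUnion_associatedPrimes_eq_compl_nonZeroDivisors]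
        exact hcon
  have := hp.isPrime
  have hnontriv : Nontrivial (Localization.AtPrime p ⊗[R] M) := by
    have hsupp : (⟨p, this⟩ : PrimeSpectrum R) ∈ Module.support R M := by
      rw [Module.support_eq_zeroLocus]
      exact hle
    have := Module.mem_support_iff.1 hsupp
    exact (LocalizedModule.equivTensorProduct p.primeCompl M).symm.toEquiv.nontrivial
  have hrpos : 0 < r := by
    obtain ⟨hfree, hrank⟩ := hr p hp
    rw [← hrank]
    exact Module.finrank_pos_iff_of_free _ _ |>.2 hnontriv
  obtain ⟨a, ha, ha0⟩ := Submodule.exists_mem_ne_zero_of_ne_bot hne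
  obtain ⟨q, hq, hqa⟩ := exists_le_isAssociatedPrime_of_isNoetherianRing R a ha0
  have := hq.isPrime
  obtain ⟨hfree, hrank⟩ := hr q hq
  have : Nontrivial (Localization.AtPrime q ⊗[R] M) := by
    apply Module.nontrivial_of_finrank_pos (R := Localization.AtPrime q)
    omega
  have hzero : algebraMap R (Localization.AtPrime q) a = 0 := by
    refine FaithfulSMul.eq_of_smul_eq_smul (α := Localization.AtPrime q ⊗[R] M) fun x ↦ ?_
    rw [zero_smul, algebraMap_smul]
    induction x with
    | zero => simp
    | tmul c y =>
      rw [← TensorProduct.tmul_smul, Module.mem_annihilator.1 ha, TensorProduct.tmul_zero]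
    | add x y hx hy => rw [smul_add, hx, hy, add_zero]
  obtain ⟨t, ht⟩ := (IsLocalization.map_eq_zero_iff q.primeCompl _ _).1 hzero
  exact t.2 (hqa (by simpa [Submodule.mem_colon_singleton] using ht))

/-- If `f : R → S` is a surjective local homomorphism of noetherian local rings with
`fd_R S < ∞` which is not an isomorphism, then `ker f` contains a non-zerodivisor of `R`. -/
theorem ker_contains_regular_of_surjective {R S : Type u} [CommRing R] [CommRing S]
    [IsLocalRing R] [IsLocalRing S] [IsNoetherianRing R] [IsNoetherianRing S]
    (f : R →+* S) (hloc : IsLocalHom f) (hsurj : Function.Surjective f)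
    (hfd : flatDimAlong f < ⊤) (hniso : ¬ Function.Bijective f) :
    ∃ a : R, a ∈ RingHom.ker f ∧ a ∈ nonZeroDivisors R := by
  let := f.toModule
  obtain ⟨_, ⟨n, hn, rfl⟩, -⟩ := sInf_lt_iff.1 hfd
  have hsmul : ∀ (a : R) (x : S), a • x = f a * x := fun _ _ ↦ rfl
  have : Module.Finite R S := Module.Finite.of_surjective (LinearMap.toSpanSingleton R S 1)
    fun x ↦ (hsurj x).imp fun a ha ↦ by simp [hsmul, ha]
  have hann : Module.annihilator R S = RingHom.ker f := by
    ext a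
    simp only [Module.mem_annihilator, hsmul, RingHom.mem_ker]
    exact ⟨fun h ↦ by simpa using h 1, fun h x ↦ by simp [h]⟩
  rw [← hann]
  refine fdLE.exists_mem_annihilator_mem_nonZeroDivisors hn fun h ↦ hniso ⟨?_, hsurj⟩
  rwa [RingHom.injective_iff_ker_eq_bot, ← hann]
end

section
/- Let f:(R,m,k) → (S,n,l) be a (local) homomorphism of noetherian local rings, M an S-module, and M^∨ = Hom_S(M, E_S(l)) where E_S(l) is the injective envelope of the residue field l as an S-module. Suppose that either R has a dualizing complex or M is an artinian S-module. Then Gfd_R(M) = Gid_R(M^∨). -/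
/- ## Preliminary definitions -/

universe u

open IsLocalRing

/- ## Dualizing complexes -/

noncomputable section

/-- The data of a `ℤ`-indexed sequence of modules with degree `+1` maps. -/
structure CochainData (R : Type u) [CommRing R] where
  D : ℤ → Type u
  [instAdd : ∀ i, AddCommGroup (D i)]
  [instMod : ∀ i, Module R (D i)]
  d : (i : ℤ) → D i →ₗ[R] D (i + 1)

attribute [instance] CochainData.instAdd CochainData.instMod

namespace CochainData

variable {R : Type u} [CommRing R] (C : CochainData R)

/-- Transport along an equality of indices. -/
def cast {a b : ℤ} (h : a = b) : C.D a →ₗ[R] C.D b := by subst h; exact LinearMap.id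

/-- Degree `n` component of the endomorphism Hom-complex `Hom(C, C)`. -/
abbrev Hc (n : ℤ) : Type u := ∀ i : ℤ, C.D i →ₗ[R] C.D (i + n)

/-- Transport along an equality of degrees in the Hom-complex. -/
def hcast {a b : ℤ} (h : a = b) (x : C.Hc a) : C.Hc b := h ▸ x

/-- The differential of the endomorphism Hom-complex:
`δ(φ) = d ∘ φ - (-1)ⁿ φ ∘ d`. -/
def δ (n : ℤ) (φ : C.Hc n) : C.Hc (n + 1) := fun i =>
  (C.cast (show i + n + 1 = i + (n + 1) by ring)).comp ((C.d (i + n)).comp (φ i)) -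
    (Int.negOnePow n : ℤ) •
      (C.cast (show i + 1 + n = i + (n + 1) by ring)).comp ((φ (i + 1)).comp (C.d i))

/-- The canonical degree-zero cocycle `r • id` of the endomorphism Hom-complex. -/
def unit (r : R) : C.Hc 0 := fun i =>
  (C.cast (show i = i + 0 by ring)).comp (r • LinearMap.id)

end CochainData

/-- A dualizing complex for `R`: a bounded complex of injective `R`-modules with finitely
generated cohomology (in particular of finite injective dimension), whose endomorphism
complex in the derived category is isomorphic to `R`, i.e. the cohomology of the Hom-complex
`Hom(D, D)` vanishes in nonzero degrees and in degree zero is isomorphic to `R` via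
`r ↦ r • id`. -/
structure DualizingComplex (R : Type u) [CommRing R] extends CochainData R where
  comp_zero : ∀ i : ℤ, (d (i + 1)).comp (d i) = 0
  injective : ∀ i, Module.Injective R (D i)
  bounded : ∃ a b : ℤ, ∀ i : ℤ, i < a ∨ b < i → Subsingleton (D i)
  finite_cohomology : ∀ i : ℤ,
    Module.Finite R
      (↥(LinearMap.ker (d (i + 1))) ⧸
        Submodule.comap (LinearMap.ker (d (i + 1))).subtype (LinearMap.range (d i)))
  hom_exact : ∀ n : ℤ, n ≠ -1 →
    Function.Exact (toCochainData.δ n) (toCochainData.δ (n + 1))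
  h0_surjective : ∀ φ : toCochainData.Hc 0, toCochainData.δ 0 φ = 0 →
    ∃ (r : R) (ψ : toCochainData.Hc (-1)),
      φ = toCochainData.unit r +
        toCochainData.hcast (by norm_num) (toCochainData.δ (-1) ψ)
  h0_injective : ∀ r : R,
    (∃ ψ : toCochainData.Hc (-1),
      toCochainData.hcast (by norm_num) (toCochainData.δ (-1) ψ) =
        toCochainData.unit r) → r = 0

/-- `R` has a dualizing complex. -/
def HasDualizingComplex (R : Type u) [CommRing R] : Prop :=
  Nonempty (DualizingComplex R)

end

/-! ## Short exact sequences of modules -/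

section ShortExact

variable {R : Type u} [CommRing R]

/-- The sequence `0 → A → B → C → 0` given by `i` and `p` is exact. -/
structure IsShortExact {A B C : Type u} [AddCommGroup A] [Module R A] [AddCommGroup B]
    [Module R B] [AddCommGroup C] [Module R C] (i : A →ₗ[R] B) (p : B →ₗ[R] C) : Prop where
  inj : Function.Injective i
  exact : Function.Exact i p
  surj : Function.Surjective p

variable {A B C D X Y : Type u} [AddCommGroup A] [Module R A] [AddCommGroup B] [Module R B]
  [AddCommGroup C] [Module R C] [AddCommGroup D] [Module R D] [AddCommGroup X] [Module R X]
  [AddCommGroup Y] [Module R Y]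

theorem exists_lift_of_injective {f : B →ₗ[R] C} (hf : Function.Injective f) (g : A →ₗ[R] C)
    (h : ∀ a, ∃ b, f b = g a) : ∃ k : A →ₗ[R] B, ∀ a, f (k a) = g a := by
  refine ⟨(LinearEquiv.ofInjective f hf).symm.toLinearMap ∘ₗ g.codRestrict (LinearMap.range f) h,
    fun a ↦ ?_⟩
  have := (LinearEquiv.ofInjective f hf).apply_symm_apply (g.codRestrict (LinearMap.range f) h a)
  exact congrArg Subtype.val this

theorem exists_desc_of_surjective {p : B →ₗ[R] C} (hp : Function.Surjective p) (g : B →ₗ[R] D)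
    (h : ∀ b, p b = 0 → g b = 0) : ∃ k : C →ₗ[R] D, ∀ b, k (p b) = g b := by
  refine ⟨(LinearMap.ker p).liftQ g (fun b hb ↦ h b hb) ∘ₗ
    (p.quotKerEquivOfSurjective hp).symm.toLinearMap, fun b ↦ ?_⟩
  have : (p.quotKerEquivOfSurjective hp).symm (p b) = (LinearMap.ker p).mkQ b := by
    rw [LinearEquiv.symm_apply_eq]; rfl
  rw [LinearMap.comp_apply, LinearEquiv.coe_coe, this]
  rfl

theorem exists_extension [Module.Injective R D] {i : A →ₗ[R] B} (hi : Function.Injective i)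
    (g : A →ₗ[R] D) : ∃ k : B →ₗ[R] D, ∀ a, k (i a) = g a :=
  Module.Injective.out i hi g

theorem injective_prod [Module.Injective R A] [Module.Injective R B] :
    Module.Injective R (A × B) where
  out X Y _ _ _ _ f hf g := by
    obtain ⟨h₁, H₁⟩ := exists_extension hf (LinearMap.fst R A B ∘ₗ g)
    obtain ⟨h₂, H₂⟩ := exists_extension hf (LinearMap.snd R A B ∘ₗ g)
    exact ⟨h₁.prod h₂, fun x ↦ Prod.ext (H₁ x) (H₂ x)⟩

namespace IsShortExact

theorem comp_eq_zero {i : A →ₗ[R] B} {p : B →ₗ[R] C} (h : IsShortExact i p) (a : A) :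
    p (i a) = 0 :=
  (h.exact _).2 ⟨a, rfl⟩

theorem exists_of_eq_zero {i : A →ₗ[R] B} {p : B →ₗ[R] C} (h : IsShortExact i p) {b : B}
    (hb : p b = 0) : ∃ a, i a = b :=
  (h.exact b).1 hb

theorem of_injective {i : A →ₗ[R] B} (hi : Function.Injective i) :
    IsShortExact i (LinearMap.range i).mkQ :=
  ⟨hi, fun b ↦ by simp, Submodule.mkQ_surjective _⟩

theorem of_surjective {p : B →ₗ[R] C} (hp : Function.Surjective p) :
    IsShortExact (LinearMap.ker p).subtype p :=
  ⟨Subtype.val_injective, fun b ↦ by simp, hp⟩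

theorem inl_snd : IsShortExact (LinearMap.inl R A B) (LinearMap.snd R A B) :=
  ⟨LinearMap.inl_injective, Function.Exact.inl_snd, LinearMap.snd_surjective⟩

theorem congr_left {i : A →ₗ[R] B} {p : B →ₗ[R] C} (h : IsShortExact i p) (e : D ≃ₗ[R] A) :
    IsShortExact (i ∘ₗ e.toLinearMap) p :=
  ⟨h.inj.comp e.injective, fun b ↦ by
    rw [h.exact b]; simp [e.surjective.exists, Set.mem_range], h.surj⟩

theorem congr_right {i : A →ₗ[R] B} {p : B →ₗ[R] C} (h : IsShortExact i p) (e : C ≃ₗ[R] D) :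
    IsShortExact i (e.toLinearMap ∘ₗ p) :=
  ⟨h.inj, fun b ↦ by rw [← h.exact b]; simp, e.surjective.comp h.surj⟩

theorem pi {ι : Type u} {A B C : ι → Type u} [∀ t, AddCommGroup (A t)] [∀ t, Module R (A t)]
    [∀ t, AddCommGroup (B t)] [∀ t, Module R (B t)] [∀ t, AddCommGroup (C t)]
    [∀ t, Module R (C t)] {i : ∀ t, A t →ₗ[R] B t} {p : ∀ t, B t →ₗ[R] C t}
    (h : ∀ t, IsShortExact (i t) (p t)) :
    IsShortExact (LinearMap.pi fun t ↦ i t ∘ₗ LinearMap.proj t)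
      (LinearMap.pi fun t ↦ p t ∘ₗ LinearMap.proj t) where
  inj x y hxy := funext fun t ↦ (h t).inj (congrFun hxy t)
  exact b := by
    refine ⟨fun hb ↦ ?_, ?_⟩
    · choose a ha using fun t ↦ (h t).exists_of_eq_zero (congrFun hb t)
      exact ⟨a, funext ha⟩
    · rintro ⟨a, rfl⟩
      exact funext fun t ↦ (h t).comp_eq_zero (a t)
  surj c := by
    choose b hb using fun t ↦ (h t).surj (c t)
    exact ⟨b, funext hb⟩

theorem prod {i : A →ₗ[R] B} {p : B →ₗ[R] C} {i' : D →ₗ[R] X} {p' : X →ₗ[R] Y}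
    (h : IsShortExact i p) (h' : IsShortExact i' p') :
    IsShortExact (i.prodMap i') (p.prodMap p') where
  inj := by
    rintro ⟨x, y⟩ ⟨x', y'⟩ hxy
    simp only [LinearMap.prodMap_apply, Prod.mk.injEq] at hxy
    rw [h.inj hxy.1, h'.inj hxy.2]
  exact := by
    rintro ⟨b, x⟩
    refine ⟨fun hb ↦ ?_, ?_⟩
    · simp only [LinearMap.prodMap_apply, Prod.mk_eq_zero] at hb
      obtain ⟨a, rfl⟩ := h.exists_of_eq_zero hb.1
      obtain ⟨d, rfl⟩ := h'.exists_of_eq_zero hb.2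
      exact ⟨(a, d), rfl⟩
    · rintro ⟨⟨a, d⟩, hh⟩
      rw [← hh]
      simp [h.comp_eq_zero, h'.comp_eq_zero]
  surj := by
    rintro ⟨c, y⟩
    obtain ⟨b, rfl⟩ := h.surj c
    obtain ⟨x, rfl⟩ := h'.surj y
    exact ⟨(b, x), rfl⟩

/-- Two quotients of `B` by the same submodule are isomorphic. -/
theorem nonempty_equiv {i : A →ₗ[R] B} {p : B →ₗ[R] C} (h : IsShortExact i p) :
    Nonempty ((B ⧸ LinearMap.range i) ≃ₗ[R] C) := by
  have hk : LinearMap.range i = LinearMap.ker p := (LinearMap.exact_iff.1 h.exact).symm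
  exact ⟨(Submodule.quotEquivOfEq _ _ hk).trans (p.quotKerEquivOfSurjective h.surj)⟩

/-- A short exact sequence with a retraction splits. -/
theorem nonempty_equiv_prod_of_retraction {i : A →ₗ[R] B} {p : B →ₗ[R] C}
    (h : IsShortExact i p) (r : B →ₗ[R] A) (hr : ∀ a, r (i a) = a) :
    Nonempty (B ≃ₗ[R] A × C) := by
  refine ⟨LinearEquiv.ofBijective (r.prod p) ⟨?_, ?_⟩⟩
  · rw [injective_iff_map_eq_zero]
    intro b hb
    have h₁ : r b = 0 := congrArg Prod.fst hb
    have h₂ : p b = 0 := congrArg Prod.snd hb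
    obtain ⟨a, rfl⟩ := h.exists_of_eq_zero h₂
    rw [← hr a, h₁, map_zero]
  · rintro ⟨a, c⟩
    obtain ⟨b, rfl⟩ := h.surj c
    refine ⟨i (a - r b) + b, ?_⟩
    simp [hr, h.comp_eq_zero]

/-- A short exact sequence with a section splits. -/
theorem nonempty_equiv_prod_of_section {i : A →ₗ[R] B} {p : B →ₗ[R] C}
    (h : IsShortExact i p) (s : C →ₗ[R] B) (hs : ∀ c, p (s c) = c) :
    Nonempty (B ≃ₗ[R] A × C) := by
  obtain ⟨r, hr⟩ := exists_lift_of_injective h.inj (LinearMap.id - s ∘ₗ p)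
    (fun b ↦ h.exists_of_eq_zero (by simp [hs]))
  exact h.nonempty_equiv_prod_of_retraction r fun a ↦ h.inj (by simp [hr, h.comp_eq_zero])

/-- The pushout `(B × D) / A` of `i : A → B` and `j : A → D`, together with its two short exact
sequences. -/
theorem exists_pushout {i : A →ₗ[R] B} {p : B →ₗ[R] C} (h : IsShortExact i p)
    {j : A →ₗ[R] D} {q : D →ₗ[R] X} (h' : IsShortExact j q) :
    ∃ (P : ModuleCat.{u} R) (b : B →ₗ[R] P) (d : D →ₗ[R] P) (pc : P →ₗ[R] C) (px : P →ₗ[R] X),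
      IsShortExact d pc ∧ IsShortExact b px := by
  let k : A →ₗ[R] B × D := i.prod (-j)
  let m := (LinearMap.range k).mkQ
  have hm : ∀ z, m z = 0 ↔ ∃ a, k a = z := fun z ↦ by simp [m]
  have hms : Function.Surjective m := Submodule.mkQ_surjective _
  obtain ⟨pc, hpc⟩ := exists_desc_of_surjective hms (p ∘ₗ LinearMap.fst R B D) (by
    intro z hz; obtain ⟨a, rfl⟩ := (hm z).1 hz; simp [k, h.comp_eq_zero])
  obtain ⟨px, hpx⟩ := exists_desc_of_surjective hms (q ∘ₗ LinearMap.snd R B D) (by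
    intro z hz; obtain ⟨a, rfl⟩ := (hm z).1 hz; simp [k, h'.comp_eq_zero])
  refine ⟨ModuleCat.of R ((B × D) ⧸ LinearMap.range k), m ∘ₗ LinearMap.inl R B D,
    m ∘ₗ LinearMap.inr R B D, pc, px, ⟨?_, ?_, ?_⟩, ⟨?_, ?_, ?_⟩⟩
  · rw [injective_iff_map_eq_zero]
    intro d hd
    obtain ⟨a, ha⟩ := (hm _).1 hd
    have h1 : i a = 0 := congrArg Prod.fst ha
    have h2 : -j a = d := congrArg Prod.snd ha
    have : a = 0 := h.inj (by simpa using h1)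
    rw [← h2, this]; simp
  · intro z
    obtain ⟨⟨b, d⟩, rfl⟩ := hms z
    refine ⟨fun hz ↦ ?_, ?_⟩
    · obtain ⟨a, rfl⟩ := h.exists_of_eq_zero (b := b) (by simpa using (hpc _).symm.trans hz)
      refine ⟨d + j a, ?_⟩
      refine sub_eq_zero.1 ?_
      change m (0, d + j a) - m (i a, d) = 0
      rw [← map_sub, hm]
      exact ⟨-a, by simp [k]⟩
    · rintro ⟨d', hd'⟩
      rw [← hd']
      exact (hpc _).trans (by simp)
  · intro c
    obtain ⟨b, rfl⟩ := h.surj c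
    exact ⟨m (b, 0), (hpc _).trans (by simp)⟩
  · rw [injective_iff_map_eq_zero]
    intro b hb
    obtain ⟨a, ha⟩ := (hm _).1 hb
    have h1 : i a = b := congrArg Prod.fst ha
    have h2 : -j a = 0 := congrArg Prod.snd ha
    have : a = 0 := h'.inj (by simpa using h2)
    rw [← h1, this]; simp
  · intro z
    obtain ⟨⟨b, d⟩, rfl⟩ := hms z
    refine ⟨fun hz ↦ ?_, ?_⟩
    · obtain ⟨a, rfl⟩ := h'.exists_of_eq_zero (b := d) (by simpa using (hpx _).symm.trans hz)
      refine ⟨b + i a, ?_⟩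
      refine sub_eq_zero.1 ?_
      change m (b + i a, 0) - m (b, j a) = 0
      rw [← map_sub, hm]
      exact ⟨a, by simp [k]⟩
    · rintro ⟨b', hb'⟩
      rw [← hb']
      exact (hpx _).trans (by simp)
  · intro x
    obtain ⟨d, rfl⟩ := h'.surj x
    exact ⟨m (0, d), (hpx _).trans (by simp)⟩

/-- For `A ⊆ B` and `B ⊆ X`, the sequence `0 → B / A → X / A → X / B → 0`. -/
theorem exists_third_iso {i : A →ₗ[R] B} {p : B →ₗ[R] C} (h : IsShortExact i p)
    {j : B →ₗ[R] X} {q : X →ₗ[R] Y} (h' : IsShortExact j q) :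
    ∃ (P : ModuleCat.{u} R) (m : X →ₗ[R] P) (c : C →ₗ[R] P) (y : P →ₗ[R] Y),
      IsShortExact (j ∘ₗ i) m ∧ IsShortExact c y ∧ (∀ x, y (m x) = q x) := by
  have hji : Function.Injective (j ∘ₗ i) := h'.inj.comp h.inj
  have hm := of_injective hji
  set m := (LinearMap.range (j ∘ₗ i)).mkQ
  obtain ⟨c, hc⟩ := exists_desc_of_surjective h.surj (m ∘ₗ j) (by
    intro b hb; obtain ⟨a, rfl⟩ := h.exists_of_eq_zero hb; exact hm.comp_eq_zero a)
  obtain ⟨y, hy⟩ := exists_desc_of_surjective hm.surj q (by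
    intro x hx; obtain ⟨a, rfl⟩ := hm.exists_of_eq_zero hx; exact h'.comp_eq_zero _)
  refine ⟨ModuleCat.of R (X ⧸ LinearMap.range (j ∘ₗ i)), m, c, y, hm, ⟨?_, ?_, ?_⟩, hy⟩
  · rw [injective_iff_map_eq_zero]
    intro z hz
    obtain ⟨b, rfl⟩ := h.surj z
    obtain ⟨a, ha⟩ := hm.exists_of_eq_zero ((hc b).symm.trans hz)
    rw [← h'.inj ha, h.comp_eq_zero]
  · intro z
    obtain ⟨x, rfl⟩ := hm.surj z
    refine ⟨fun hz ↦ ?_, ?_⟩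
    · obtain ⟨b, rfl⟩ := h'.exists_of_eq_zero ((hy x).symm.trans hz)
      exact ⟨p b, hc b⟩
    · rintro ⟨z, hz⟩
      obtain ⟨b, rfl⟩ := h.surj z
      rw [← hz, hc]
      exact (hy _).trans (h'.comp_eq_zero b)
  · intro z
    obtain ⟨x, rfl⟩ := h'.surj z
    exact ⟨m x, hy x⟩

/-- The kernel of a composite of surjections. -/
theorem exists_ker_comp {i : A →ₗ[R] B} {p : B →ₗ[R] C} (h : IsShortExact i p)
    {j : D →ₗ[R] C} {q : C →ₗ[R] X} (h' : IsShortExact j q) :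
    ∃ (K : ModuleCat.{u} R) (k : K →ₗ[R] B) (a : A →ₗ[R] K) (d : K →ₗ[R] D),
      IsShortExact k (q ∘ₗ p) ∧ IsShortExact a d := by
  have hqp : Function.Surjective (q ∘ₗ p) := h'.surj.comp h.surj
  have hk := of_surjective hqp
  set k := (LinearMap.ker (q ∘ₗ p)).subtype
  obtain ⟨a, ha⟩ := exists_lift_of_injective hk.inj i
    (fun x ↦ hk.exists_of_eq_zero (by simp [h.comp_eq_zero]))
  obtain ⟨d, hd⟩ := exists_lift_of_injective h'.inj (p ∘ₗ k)
    (fun x ↦ h'.exists_of_eq_zero (hk.comp_eq_zero x))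
  refine ⟨ModuleCat.of R (LinearMap.ker (q ∘ₗ p)), k, a, d, hk, ⟨?_, ?_, ?_⟩⟩
  · intro x y hxy
    exact h.inj (by rw [← ha, ← ha, hxy])
  · intro x
    refine ⟨fun hx ↦ ?_, ?_⟩
    · have : p (k x) = 0 := by have := hd x; rw [hx, map_zero] at this; exact this.symm
      obtain ⟨z, hz⟩ := h.exists_of_eq_zero this
      exact ⟨z, hk.inj (by rw [ha, hz])⟩
    · rintro ⟨z, rfl⟩
      apply h'.inj
      rw [hd, map_zero, LinearMap.comp_apply, ha, h.comp_eq_zero]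
  · intro z
    obtain ⟨b, hb⟩ := h.surj (j z)
    obtain ⟨x, hx⟩ := hk.exists_of_eq_zero (b := b) (by simp [hb, h'.comp_eq_zero])
    exact ⟨x, h'.inj (by rw [hd, LinearMap.comp_apply, hx, hb])⟩

end IsShortExact

end ShortExact

/-! ## Gorenstein injective modules -/

section ExtVanishing

variable {R : Type u} [CommRing R]

/-- `Ext¹(J, N) = 0` for every injective module `J`: maps from `J` lift along every surjection
with kernel `N`. -/
def InjectiveExtVanishing (R : Type u) [CommRing R] (N : Type u) [AddCommGroup N]
    [Module R N] : Prop :=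
  ∀ (J X Y : Type u) [AddCommGroup J] [Module R J] [AddCommGroup X] [Module R X] [AddCommGroup Y]
    [Module R Y] (i : N →ₗ[R] X) (p : X →ₗ[R] Y), Module.Injective R J → IsShortExact i p →
    ∀ φ : J →ₗ[R] Y, ∃ ψ : J →ₗ[R] X, ∀ x, p (ψ x) = φ x

variable {A B C N W I Y : Type u} [AddCommGroup A] [Module R A] [AddCommGroup B] [Module R B]
  [AddCommGroup C] [Module R C] [AddCommGroup N] [Module R N] [AddCommGroup W] [Module R W]
  [AddCommGroup I] [Module R I] [AddCommGroup Y] [Module R Y]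

/-- The vanishing of `Ext¹(J, N)` can be tested on one embedding of `N` into an injective. -/
theorem InjectiveExtVanishing.of_isShortExact [Module.Injective R I] {i : N →ₗ[R] I}
    {p : I →ₗ[R] Y} (h : IsShortExact i p)
    (hlift : ∀ (J : Type u) [AddCommGroup J] [Module R J], Module.Injective R J →
      ∀ φ : J →ₗ[R] Y, ∃ ψ : J →ₗ[R] I, ∀ x, p (ψ x) = φ x) :
    InjectiveExtVanishing R N := by
  intro J X Z _ _ _ _ _ _ j q hJ hjq φ
  obtain ⟨α, hα⟩ := exists_extension hjq.inj i
  obtain ⟨β, hβ⟩ := exists_desc_of_surjective hjq.surj (p ∘ₗ α) (by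
    intro x hx
    obtain ⟨n, rfl⟩ := hjq.exists_of_eq_zero hx
    simp [hα, h.comp_eq_zero])
  obtain ⟨l, hl⟩ := hlift J hJ (β ∘ₗ φ)
  have hinj : Function.Injective (α.prod q) := by
    rw [injective_iff_map_eq_zero]
    intro x hx
    obtain ⟨n, rfl⟩ := hjq.exists_of_eq_zero (congrArg Prod.snd hx)
    have hn : i n = 0 := (hα n).symm.trans (congrArg Prod.fst hx)
    rw [h.inj (hn.trans (map_zero i).symm), map_zero]
  obtain ⟨ψ, hψ⟩ := exists_lift_of_injective hinj (l.prod φ) (by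
    intro x
    obtain ⟨y, hy⟩ := hjq.surj (φ x)
    have hp : p (l x - α y) = 0 := by
      rw [map_sub, hl, LinearMap.comp_apply, ← hy, hβ, LinearMap.comp_apply, sub_self]
    obtain ⟨n, hn⟩ := h.exists_of_eq_zero hp
    refine ⟨y + j n, Prod.ext ?_ ?_⟩
    · simp [hα, hn]
    · simp [hy, hjq.comp_eq_zero])
  exact ⟨ψ, fun x ↦ congrArg Prod.snd (hψ x)⟩

theorem InjectiveExtVanishing.of_injective [Module.Injective R N] :
    InjectiveExtVanishing R N := by
  intro J X Y _ _ _ _ _ _ i p _ hip φ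
  obtain ⟨r, hr⟩ := exists_extension hip.inj (LinearMap.id : N →ₗ[R] N)
  obtain ⟨s, hs⟩ := exists_desc_of_surjective hip.surj (LinearMap.id - i ∘ₗ r) (by
    intro x hx
    obtain ⟨n, rfl⟩ := hip.exists_of_eq_zero hx
    simp [hr])
  refine ⟨s ∘ₗ φ, fun x ↦ ?_⟩
  obtain ⟨y, hy⟩ := hip.surj (φ x)
  simp [← hy, hs, hip.comp_eq_zero]

theorem InjectiveExtVanishing.of_equiv (h : InjectiveExtVanishing R N) (e : N ≃ₗ[R] W) :
    InjectiveExtVanishing R W :=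
  fun J X Y _ _ _ _ _ _ _ p hJ hip ↦ h J X Y _ p hJ (hip.congr_left e)

theorem InjectiveExtVanishing.of_extension (hA : InjectiveExtVanishing R A)
    (hC : InjectiveExtVanishing R C) {i : A →ₗ[R] B} {p : B →ₗ[R] C} (h : IsShortExact i p) :
    InjectiveExtVanishing R B := by
  intro J X Y _ _ _ _ _ _ j q hJ hjq φ
  obtain ⟨P, m, c, y, hm, hcy, hym⟩ := h.exists_third_iso hjq
  obtain ⟨ψ, hψ⟩ := hC J P Y c y hJ hcy φ
  obtain ⟨χ, hχ⟩ := hA J X P _ m hJ hm ψ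
  exact ⟨χ, fun x ↦ by rw [← hym, hχ, hψ]⟩

theorem InjectiveExtVanishing.of_prod (h : InjectiveExtVanishing R (N × W)) :
    InjectiveExtVanishing R N := by
  intro J X Y _ _ _ _ _ _ i p hJ hip φ
  have h' : IsShortExact (i.prodMap (LinearMap.id : W →ₗ[R] W)) (p ∘ₗ LinearMap.fst R X W) := by
    refine ⟨?_, ?_, hip.surj.comp LinearMap.fst_surjective⟩
    · rintro ⟨x, y⟩ ⟨x', y'⟩ hxy
      simp only [LinearMap.prodMap_apply, LinearMap.id_apply, Prod.mk.injEq] at hxy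
      exact Prod.ext (hip.inj hxy.1) hxy.2
    · rintro ⟨x, w⟩
      refine ⟨fun hx ↦ ?_, ?_⟩
      · obtain ⟨n, rfl⟩ := hip.exists_of_eq_zero (b := x) hx
        exact ⟨(n, w), rfl⟩
      · rintro ⟨n, hn⟩
        rw [← hn]
        simp [hip.comp_eq_zero]
  obtain ⟨ψ, hψ⟩ := h J (X × W) Y _ _ hJ h' φ
  exact ⟨LinearMap.fst R X W ∘ₗ ψ, hψ⟩

end ExtVanishing

section Chains

/-- A relation in which every element of `P` has a successor and a predecessor in `P` admits
two-sided infinite chains. -/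
theorem exists_int_chain {α : Type*} {P : α → Prop} {r : α → α → Prop}
    (left : ∀ a, P a → ∃ b, P b ∧ r b a) (right : ∀ a, P a → ∃ b, P b ∧ r a b) {a : α}
    (ha : P a) : ∃ z : ℤ → α, z 1 = a ∧ ∀ i, r (z (i + 1)) (z i) := by
  choose l hl using fun x : {x // P x} ↦ left x.1 x.2
  choose q hq using fun x : {x // P x} ↦ right x.1 x.2
  let L : {x // P x} → {x // P x} := fun x ↦ ⟨l x, (hl x).1⟩
  let Q : {x // P x} → {x // P x} := fun x ↦ ⟨q x, (hq x).1⟩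
  let z : ℤ → α
    | Int.ofNat n => (L^[n] ⟨a, ha⟩).1
    | Int.negSucc n => (Q^[n + 1] ⟨a, ha⟩).1
  suffices hz : ∀ i, r (z (i + 1)) (z i) from
    ⟨fun i ↦ z (i - 1), rfl, fun i ↦ by
      have := hz (i - 1)
      rw [sub_add_cancel] at this
      change r (z (i + 1 - 1)) (z (i - 1))
      rwa [add_sub_cancel_right]⟩
  rintro (n | n)
  · change r (L^[n + 1] ⟨a, ha⟩).1 (L^[n] ⟨a, ha⟩).1
    rw [Function.iterate_succ_apply']
    exact (hl _).2
  · obtain - | n := n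
    · exact (hq ⟨a, ha⟩).2
    · change r (Q^[n + 1] ⟨a, ha⟩).1 (Q^[n + 1 + 1] ⟨a, ha⟩).1
      rw [Function.iterate_succ_apply' _ (n + 1)]
      exact (hq _).2

end Chains

section GorensteinInjective

variable {R : Type u} [CommRing R]

/-- There is an exact sequence `0 → A → I → B → 0` with `I` injective. -/
def InjectiveStep (A B : ModuleCat.{u} R) : Prop :=
  ∃ (I : ModuleCat.{u} R) (i : A →ₗ[R] I) (p : I →ₗ[R] B),
    Module.Injective R I ∧ IsShortExact i p

/-- A class of modules with vanishing `Ext¹(J, -)` for injective `J` whose members are quotients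
and submodules of injectives with kernels and cokernels again in the class. -/
structure IsGorensteinInjectiveClass (P : ModuleCat.{u} R → Prop) : Prop where
  extVanishing : ∀ N, P N → InjectiveExtVanishing R N
  left : ∀ N, P N → ∃ N', P N' ∧ InjectiveStep N' N
  right : ∀ N, P N → ∃ N', P N' ∧ InjectiveStep N N'

theorem IsGorensteinInjectiveClass.isGorensteinInjective {P : ModuleCat.{u} R → Prop}
    (hP : IsGorensteinInjectiveClass P) {N : Type u} [AddCommGroup N] [Module R N]
    (hN : P (ModuleCat.of R N)) : IsGorensteinInjective R N := by
  obtain ⟨z, hz1, hz⟩ := exists_int_chain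
    (r := fun A B : ModuleCat.{u} R ↦ InjectiveStep A B ∧ P A)
    (fun a ha ↦ (hP.left a ha).imp fun b hb ↦ ⟨hb.1, hb.2, hb.1⟩)
    (fun a ha ↦ (hP.right a ha).imp fun b hb ↦ ⟨hb.1, hb.2, ha⟩) hN
  choose I i p hI hip using fun k ↦ (hz k).1
  have hiz : ∀ k, Function.Injective (i k) := fun k ↦ (hip k).inj
  have hpz : ∀ k, Function.Surjective (p k) := fun k ↦ (hip k).surj
  refine ⟨{ I := fun k ↦ I k
            d := fun k ↦ i k ∘ₗ p (k + 1)
            injective := hI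
            exact := fun k x ↦ ?_
            exact_hom := fun E _ _ hE k φ ↦ ?_
            iso := ?_ }⟩
  · refine ⟨fun hx ↦ ?_, ?_⟩
    · have : p (k + 1) x = 0 := hiz k (by simpa using hx)
      obtain ⟨y, rfl⟩ := (hip (k + 1)).exists_of_eq_zero this
      obtain ⟨w, rfl⟩ := hpz (k + 1 + 1) y
      exact ⟨w, rfl⟩
    · rintro ⟨w, rfl⟩
      simp [(hip (k + 1)).comp_eq_zero]
  · refine ⟨fun hφ ↦ ?_, ?_⟩
    · have hφ' : ∀ x, p (k + 1) (φ x) = 0 := fun x ↦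
        hiz k (by simpa using LinearMap.congr_fun hφ x)
      obtain ⟨χ, hχ⟩ := exists_lift_of_injective (hiz (k + 1)) φ
        (fun x ↦ (hip (k + 1)).exists_of_eq_zero (hφ' x))
      obtain ⟨ψ, hψ⟩ := hP.extVanishing _ (hz (k + 1 + 1)).2 E _ _ _ _ hE (hip (k + 1 + 1)) χ
      exact ⟨ψ, LinearMap.ext fun x ↦ by simp [hψ, hχ]⟩
    · rintro ⟨ψ, rfl⟩
      exact LinearMap.ext fun x ↦ by simp [(hip (k + 1)).comp_eq_zero]
  · have hr : LinearMap.range (i 0 ∘ₗ p (0 + 1)) = LinearMap.range (i 0) :=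
      LinearMap.range_comp_of_range_eq_top _ (LinearMap.range_eq_top.2 (hpz _))
    have e : z (0 + 1) ≃ₗ[R] N := (CategoryTheory.eqToIso hz1).toLinearEquiv
    exact ⟨e.symm.trans ((LinearEquiv.ofInjective _ (hiz 0)).trans (LinearEquiv.ofEq _ _ hr.symm))⟩

attribute [local instance] GorensteinInjectiveWitness.instAdd GorensteinInjectiveWitness.instMod

theorem GorensteinInjectiveWitness.isShortExact {J : Type u} [AddCommGroup J] [Module R J]
    (w : GorensteinInjectiveWitness R J) (k : ℤ) :
    IsShortExact (LinearMap.range (w.d (k + 1))).subtype (w.d k).rangeRestrict :=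
  ⟨Subtype.val_injective, fun x ↦ by
    rw [← LinearMap.mem_ker, LinearMap.ker_rangeRestrict, LinearMap.mem_ker, w.exact k x]
    simp, LinearMap.surjective_rangeRestrict _⟩

theorem exists_class_of_isGorensteinInjective {N : Type u} [AddCommGroup N] [Module R N]
    (h : IsGorensteinInjective R N) :
    ∃ P : ModuleCat.{u} R → Prop, IsGorensteinInjectiveClass P ∧ P (ModuleCat.of R N) := by
  obtain ⟨w⟩ := h
  refine ⟨fun X ↦ ∃ k, Nonempty (X ≃ₗ[R] LinearMap.range (w.d k)), ⟨?_, ?_, ?_⟩, 0, w.iso⟩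
  · rintro X ⟨k, ⟨e⟩⟩
    obtain ⟨k, rfl⟩ : ∃ l, k = l + 1 + 1 := ⟨k - 1 - 1, by ring⟩
    have := w.injective (k + 1 + 1)
    refine InjectiveExtVanishing.of_equiv
      (InjectiveExtVanishing.of_isShortExact (w.isShortExact (k + 1)) ?_) e.symm
    intro J _ _ hJ φ
    obtain ⟨ψ, hψ⟩ := (w.exact_hom J hJ k ((LinearMap.range (w.d (k + 1))).subtype ∘ₗ φ)).1 (by
      ext x
      obtain ⟨y, hy⟩ := (φ x).2
      exact (w.exact k _).2 ⟨y, hy⟩)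
    exact ⟨ψ, fun x ↦ Subtype.ext (LinearMap.congr_fun hψ x)⟩
  · rintro X ⟨k, ⟨e⟩⟩
    exact ⟨ModuleCat.of R (LinearMap.range (w.d (k + 1))), ⟨k + 1, ⟨LinearEquiv.refl _ _⟩⟩,
      ModuleCat.of R (w.I (k + 1)), _, _, w.injective _, (w.isShortExact k).congr_right e.symm⟩
  · rintro X ⟨k, ⟨e⟩⟩
    obtain ⟨k, rfl⟩ : ∃ l, k = l + 1 := ⟨k - 1, by ring⟩
    exact ⟨ModuleCat.of R (LinearMap.range (w.d k)), ⟨k, ⟨LinearEquiv.refl _ _⟩⟩,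
      ModuleCat.of R (w.I (k + 1)), _, _, w.injective _, (w.isShortExact k).congr_left e⟩

/-- The Gorenstein injective modules form the largest class of this kind. -/
theorem isGorensteinInjectiveClass :
    IsGorensteinInjectiveClass fun N : ModuleCat.{u} R ↦ IsGorensteinInjective R N where
  extVanishing N hN := by
    obtain ⟨P, hP, hPN⟩ := exists_class_of_isGorensteinInjective hN
    exact hP.extVanishing _ hPN
  left N hN := by
    obtain ⟨P, hP, hPN⟩ := exists_class_of_isGorensteinInjective hN
    obtain ⟨N', hN', h⟩ := hP.left _ hPN
    exact ⟨N', hP.isGorensteinInjective hN', h⟩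
  right N hN := by
    obtain ⟨P, hP, hPN⟩ := exists_class_of_isGorensteinInjective hN
    obtain ⟨N', hN', h⟩ := hP.right _ hPN
    exact ⟨N', hP.isGorensteinInjective hN', h⟩

variable {A B C N W I : Type u} [AddCommGroup A] [Module R A] [AddCommGroup B] [Module R B]
  [AddCommGroup C] [Module R C] [AddCommGroup N] [Module R N] [AddCommGroup W] [Module R W]
  [AddCommGroup I] [Module R I]

theorem IsGorensteinInjective.extVanishing (h : IsGorensteinInjective R N) :
    InjectiveExtVanishing R N :=
  isGorensteinInjectiveClass.extVanishing (ModuleCat.of R N) h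

theorem IsGorensteinInjective.exists_left (h : IsGorensteinInjective R N) :
    ∃ (K I : ModuleCat.{u} R) (i : K →ₗ[R] I) (p : I →ₗ[R] N),
      IsGorensteinInjective R K ∧ Module.Injective R I ∧ IsShortExact i p := by
  obtain ⟨K, hK, I, i, p, hI, hip⟩ := isGorensteinInjectiveClass.left (ModuleCat.of R N) h
  exact ⟨K, I, i, p, hK, hI, hip⟩

theorem IsGorensteinInjective.exists_right (h : IsGorensteinInjective R N) :
    ∃ (K I : ModuleCat.{u} R) (i : N →ₗ[R] I) (p : I →ₗ[R] K),
      IsGorensteinInjective R K ∧ Module.Injective R I ∧ IsShortExact i p := by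
  obtain ⟨K, hK, I, i, p, hI, hip⟩ := isGorensteinInjectiveClass.right (ModuleCat.of R N) h
  exact ⟨K, I, i, p, hK, hI, hip⟩

theorem IsGorensteinInjective.of_equiv (h : IsGorensteinInjective R N) (e : N ≃ₗ[R] W) :
    IsGorensteinInjective R W := by
  obtain ⟨w⟩ := h
  exact ⟨{ w with iso := w.iso.map fun e' ↦ e.symm.trans e' }⟩

theorem injective_of_subsingleton [Subsingleton N] : Module.Injective R N where
  out _ _ _ _ _ _ _ _ _ := ⟨0, fun _ ↦ Subsingleton.elim _ _⟩

theorem IsGorensteinInjective.of_injective [Module.Injective R N] :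
    IsGorensteinInjective R N := by
  have hclass : IsGorensteinInjectiveClass fun X : ModuleCat.{u} R ↦ Module.Injective R X := by
    refine ⟨fun X hX ↦ InjectiveExtVanishing.of_injective, fun X hX ↦ ?_, fun X hX ↦ ?_⟩
    · refine ⟨ModuleCat.of R PUnit, injective_of_subsingleton, X, 0, LinearMap.id, hX, ?_, ?_, ?_⟩
      · exact Function.injective_of_subsingleton _
      · intro x; simp [eq_comm]
      · exact Function.surjective_id
    · refine ⟨ModuleCat.of R PUnit, injective_of_subsingleton, X, LinearMap.id, 0, hX, ?_, ?_, ?_⟩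
      · exact Function.injective_id
      · intro x; simp
      · exact Function.surjective_to_subsingleton _
  exact hclass.isGorensteinInjective (N := N) ‹_›

theorem IsGorensteinInjective.pi {ι : Type u} {N : ι → Type u} [∀ t, AddCommGroup (N t)]
    [∀ t, Module R (N t)] (h : ∀ t, IsGorensteinInjective R (N t)) :
    IsGorensteinInjective R (∀ t, N t) := by
  have hclass : IsGorensteinInjectiveClass fun X : ModuleCat.{u} R ↦
      ∃ M : ι → ModuleCat.{u} R, (∀ t, IsGorensteinInjective R (M t)) ∧
        Nonempty (X ≃ₗ[R] ∀ t, M t) := by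
    refine ⟨?_, ?_, ?_⟩
    · rintro X ⟨M, hM, ⟨e⟩⟩
      choose K I i p hK hI hip using fun t ↦ (hM t).exists_right
      refine InjectiveExtVanishing.of_equiv
        (InjectiveExtVanishing.of_isShortExact (IsShortExact.pi hip) ?_) e.symm
      intro J _ _ hJ φ
      choose ψ hψ using fun t ↦
        (hM t).extVanishing J _ _ (i t) (p t) hJ (hip t) (LinearMap.proj t ∘ₗ φ)
      exact ⟨LinearMap.pi ψ, fun x ↦ funext fun t ↦ hψ t x⟩
    · rintro X ⟨M, hM, ⟨e⟩⟩
      choose K I i p hK hI hip using fun t ↦ (hM t).exists_left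
      exact ⟨ModuleCat.of R (∀ t, K t), ⟨K, hK, ⟨LinearEquiv.refl _ _⟩⟩,
        ModuleCat.of R (∀ t, I t), _, _, Module.Injective.pi R _,
        (IsShortExact.pi hip).congr_right e.symm⟩
    · rintro X ⟨M, hM, ⟨e⟩⟩
      choose K I i p hK hI hip using fun t ↦ (hM t).exists_right
      exact ⟨ModuleCat.of R (∀ t, K t), ⟨K, hK, ⟨LinearEquiv.refl _ _⟩⟩,
        ModuleCat.of R (∀ t, I t), _, _, Module.Injective.pi R _,
        (IsShortExact.pi hip).congr_left e⟩
  exact hclass.isGorensteinInjective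
    ⟨fun t ↦ ModuleCat.of R (N t), h, ⟨LinearEquiv.refl _ _⟩⟩

/-- The horseshoe lemma for injective covers. -/
theorem IsShortExact.exists_horseshoe_left {K I K' I' : Type u} [AddCommGroup K] [Module R K]
    [AddCommGroup I] [Module R I] [AddCommGroup K'] [Module R K'] [AddCommGroup I'] [Module R I']
    {i : A →ₗ[R] B} {p : B →ₗ[R] C} (h : IsShortExact i p) (hA : InjectiveExtVanishing R A)
    (hI' : Module.Injective R I') {a : K →ₗ[R] I} {q : I →ₗ[R] A} (ha : IsShortExact a q)
    {c : K' →ₗ[R] I'} {q' : I' →ₗ[R] C} (hc : IsShortExact c q') :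
    ∃ (L : ModuleCat.{u} R) (l : L →ₗ[R] I × I') (s : I × I' →ₗ[R] B) (x : K →ₗ[R] L)
      (y : L →ₗ[R] K'), IsShortExact l s ∧ IsShortExact x y := by
  obtain ⟨g, hg⟩ := hA I' B C i p hI' h q'
  let s : I × I' →ₗ[R] B := (i ∘ₗ q).coprod g
  have hs : Function.Surjective s := by
    intro b
    obtain ⟨e', he'⟩ := hc.surj (p b)
    obtain ⟨a', ha'⟩ := h.exists_of_eq_zero (b := b - g e') (by simp [hg, he'])
    obtain ⟨e, rfl⟩ := ha.surj a'
    exact ⟨(e, e'), by simp [s, ha']⟩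
  have hl := IsShortExact.of_surjective hs
  set l := (LinearMap.ker s).subtype
  obtain ⟨x, hx⟩ := exists_lift_of_injective hl.inj (LinearMap.inl R I I' ∘ₗ a)
    (fun k ↦ hl.exists_of_eq_zero (by simp [s, ha.comp_eq_zero]))
  have hps : ∀ z, p (s z) = q' z.2 := fun z ↦ by simp [s, h.comp_eq_zero, hg]
  obtain ⟨y, hy⟩ := exists_lift_of_injective hc.inj (LinearMap.snd R I I' ∘ₗ l)
    (fun k ↦ hc.exists_of_eq_zero (by
      rw [LinearMap.comp_apply, LinearMap.snd_apply, ← hps, hl.comp_eq_zero, map_zero]))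
  refine ⟨ModuleCat.of R (LinearMap.ker s), l, s, x, y, hl, ⟨?_, ?_, ?_⟩⟩
  · intro k k' hk
    refine ha.inj (LinearMap.inl_injective (R := R) (M₂ := I') ?_)
    exact (hx k).symm.trans ((congrArg l hk).trans (hx k'))
  · intro z
    refine ⟨fun hz ↦ ?_, ?_⟩
    · have h2 : (l z).2 = 0 := by
        have := hy z; rw [hz, map_zero] at this; exact this.symm
      have h1 : q (l z).1 = 0 := h.inj (by
        have := hl.comp_eq_zero z
        simpa [s, h2] using this)
      obtain ⟨k, hk⟩ := ha.exists_of_eq_zero h1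
      exact ⟨k, hl.inj ((hx k).trans (Prod.ext hk h2.symm))⟩
    · rintro ⟨k, rfl⟩
      apply hc.inj
      rw [hy, map_zero, LinearMap.comp_apply, hx]
      rfl
  · intro k'
    have : p (g (c k')) = 0 := by rw [hg, hc.comp_eq_zero]
    obtain ⟨a', ha'⟩ := h.exists_of_eq_zero this
    obtain ⟨e, rfl⟩ := ha.surj a'
    obtain ⟨z, hz⟩ := hl.exists_of_eq_zero (b := (-e, c k')) (by simp [s, ha'])
    refine ⟨z, hc.inj ?_⟩
    rw [hy, LinearMap.comp_apply, hz]
    rfl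

/-- The horseshoe lemma for injective embeddings. -/
theorem IsShortExact.exists_horseshoe_right {K I K' I' : Type u} [AddCommGroup K] [Module R K]
    [AddCommGroup I] [Module R I] [AddCommGroup K'] [Module R K'] [AddCommGroup I'] [Module R I']
    {i : A →ₗ[R] B} {p : B →ₗ[R] C} (h : IsShortExact i p) [Module.Injective R I]
    {a : A →ₗ[R] I} {q : I →ₗ[R] K} (ha : IsShortExact a q)
    {c : C →ₗ[R] I'} {q' : I' →ₗ[R] K'} (hc : IsShortExact c q') :
    ∃ (L : ModuleCat.{u} R) (s : B →ₗ[R] I × I') (l : I × I' →ₗ[R] L) (x : K →ₗ[R] L)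
      (y : L →ₗ[R] K'), IsShortExact s l ∧ IsShortExact x y := by
  obtain ⟨g, hg⟩ := exists_extension h.inj a
  let s : B →ₗ[R] I × I' := g.prod (c ∘ₗ p)
  have hs : Function.Injective s := by
    rw [injective_iff_map_eq_zero]
    intro b hb
    have h1 : g b = 0 := congrArg Prod.fst hb
    have h2 : p b = 0 := hc.inj ((congrArg Prod.snd hb).trans (map_zero c).symm)
    obtain ⟨a', rfl⟩ := h.exists_of_eq_zero h2
    rw [hg] at h1
    rw [ha.inj (h1.trans (map_zero a).symm), map_zero]
  have hl := IsShortExact.of_injective hs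
  set l := (LinearMap.range s).mkQ
  obtain ⟨x, hx⟩ := exists_desc_of_surjective ha.surj (l ∘ₗ LinearMap.inl R I I') (by
    intro e he
    obtain ⟨a', rfl⟩ := ha.exists_of_eq_zero he
    have : (LinearMap.inl R I I') (a a') = s (i a') := by simp [s, hg, h.comp_eq_zero]
    rw [LinearMap.comp_apply, this, hl.comp_eq_zero])
  obtain ⟨y, hy⟩ := exists_desc_of_surjective hl.surj (q' ∘ₗ LinearMap.snd R I I') (by
    intro z hz
    obtain ⟨b, rfl⟩ := hl.exists_of_eq_zero hz
    simp [s, hc.comp_eq_zero])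
  refine ⟨ModuleCat.of R ((I × I') ⧸ LinearMap.range s), s, l, x, y, hl, ⟨?_, ?_, ?_⟩⟩
  · rw [injective_iff_map_eq_zero]
    intro k hk
    obtain ⟨e, rfl⟩ := ha.surj k
    obtain ⟨b, hb⟩ := hl.exists_of_eq_zero ((hx e).symm.trans hk)
    have h1 : g b = e := congrArg Prod.fst hb
    have h2 : p b = 0 := hc.inj ((congrArg Prod.snd hb).trans (map_zero c).symm)
    obtain ⟨a', rfl⟩ := h.exists_of_eq_zero h2
    rw [← h1, hg, ha.comp_eq_zero]
  · intro w
    obtain ⟨⟨e, e'⟩, rfl⟩ := hl.surj w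
    refine ⟨fun hw ↦ ?_, ?_⟩
    · obtain ⟨c', rfl⟩ := hc.exists_of_eq_zero (b := e') ((hy _).symm.trans hw)
      obtain ⟨b, rfl⟩ := h.surj c'
      refine ⟨q (e - g b), ?_⟩
      rw [hx, ← sub_eq_zero, LinearMap.comp_apply, ← map_sub]
      have : LinearMap.inl R I I' (e - g b) - (e, c (p b)) = s (-b) := by simp [s]
      rw [this, hl.comp_eq_zero]
    · rintro ⟨k, hk⟩
      obtain ⟨e, rfl⟩ := ha.surj k
      rw [← hk, hx]
      exact (hy _).trans (by simp)
  · intro k'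
    obtain ⟨e', rfl⟩ := hc.surj k'
    exact ⟨l (0, e'), hy _⟩

theorem IsGorensteinInjective.of_extension (hA : IsGorensteinInjective R A)
    (hC : IsGorensteinInjective R C) {i : A →ₗ[R] B} {p : B →ₗ[R] C} (h : IsShortExact i p) :
    IsGorensteinInjective R B := by
  have hclass : IsGorensteinInjectiveClass fun X : ModuleCat.{u} R ↦
      ∃ (A C : ModuleCat.{u} R) (i : A →ₗ[R] X) (p : X →ₗ[R] C), IsGorensteinInjective R A ∧
        IsGorensteinInjective R C ∧ IsShortExact i p := by
    refine ⟨?_, ?_, ?_⟩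
    · rintro X ⟨A, C, i, p, hA, hC, h⟩
      exact hA.extVanishing.of_extension hC.extVanishing h
    · rintro X ⟨A, C, i, p, hA, hC, h⟩
      obtain ⟨K, I, a, q, hK, hI, ha⟩ := hA.exists_left
      obtain ⟨K', I', c, q', hK', hI', hc⟩ := hC.exists_left
      obtain ⟨L, l, s, x, y, hls, hxy⟩ := h.exists_horseshoe_left hA.extVanishing hI' ha hc
      exact ⟨L, ⟨K, K', x, y, hK, hK', hxy⟩, ModuleCat.of R (I × I'), l, s, injective_prod, hls⟩
    · rintro X ⟨A, C, i, p, hA, hC, h⟩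
      obtain ⟨K, I, a, q, hK, hI, ha⟩ := hA.exists_right
      obtain ⟨K', I', c, q', hK', hI', hc⟩ := hC.exists_right
      obtain ⟨L, s, l, x, y, hsl, hxy⟩ := h.exists_horseshoe_right ha hc
      exact ⟨L, ⟨K, K', x, y, hK, hK', hxy⟩, ModuleCat.of R (I × I'), s, l, injective_prod, hsl⟩
  exact hclass.isGorensteinInjective ⟨ModuleCat.of R A, ModuleCat.of R C, i, p, hA, hC, h⟩

theorem IsGorensteinInjective.prod (hN : IsGorensteinInjective R N)
    (hW : IsGorensteinInjective R W) : IsGorensteinInjective R (N × W) :=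
  hN.of_extension hW IsShortExact.inl_snd

/-- A direct summand with Gorenstein injective complement. -/
theorem IsGorensteinInjective.of_prod_of_right (h : IsGorensteinInjective R (N × W))
    (hW : IsGorensteinInjective R W) : IsGorensteinInjective R N := by
  have hclass : IsGorensteinInjectiveClass fun X : ModuleCat.{u} R ↦
      ∃ V : ModuleCat.{u} R, IsGorensteinInjective R V ∧ IsGorensteinInjective R (X × V) := by
    have hzero : ∀ X : ModuleCat.{u} R, IsGorensteinInjective R X →
        ∃ V : ModuleCat.{u} R, IsGorensteinInjective R V ∧ IsGorensteinInjective R (X × V) := by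
      intro X hX
      have h0 : IsGorensteinInjective R PUnit.{u + 1} := by
        have : Module.Injective R PUnit.{u + 1} := injective_of_subsingleton
        exact IsGorensteinInjective.of_injective
      exact ⟨ModuleCat.of R PUnit, h0, hX.prod h0⟩
    refine ⟨?_, ?_, ?_⟩
    · rintro X ⟨V, -, hXV⟩
      exact hXV.extVanishing.of_prod
    · rintro X ⟨V, hV, hXV⟩
      obtain ⟨K, I, i, p, hK, hI, hip⟩ := hXV.exists_left
      have hinr : IsShortExact (LinearMap.inr R X V) (LinearMap.fst R X V) :=
        ⟨LinearMap.inr_injective, Function.Exact.inr_fst, LinearMap.fst_surjective⟩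
      obtain ⟨L, l, a, d, hl, had⟩ := hip.exists_ker_comp hinr
      exact ⟨L, hzero L (hK.of_extension hV had), I, l, _, hI, hl⟩
    · rintro X ⟨V, hV, hXV⟩
      obtain ⟨K, I, i, p, hK, hI, hip⟩ := hXV.exists_right
      obtain ⟨L, m, c, y, hm, hcy, -⟩ := IsShortExact.inl_snd.exists_third_iso hip
      exact ⟨L, hzero L (hV.of_extension hK hcy), I, _, m, hI, hm⟩
  exact hclass.isGorensteinInjective ⟨ModuleCat.of R W, hW, h⟩

theorem nonempty_equiv_prod_sequence (R N : Type u) [CommRing R] [AddCommGroup N] [Module R N] :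
    Nonempty ((ULift.{u} ℕ → N) ≃ₗ[R] N × (ULift.{u} ℕ → N)) := by
  let f : (ULift.{u} ℕ → N) →ₗ[R] N × (ULift.{u} ℕ → N) :=
    (LinearMap.proj ⟨0⟩).prod (LinearMap.funLeft R N fun t ↦ ⟨t.down + 1⟩)
  refine ⟨LinearEquiv.ofBijective f ⟨fun x y hxy ↦ ?_, fun z ↦ ?_⟩⟩
  · funext ⟨n⟩
    obtain - | n := n
    · exact congrArg Prod.fst hxy
    · exact congrFun (congrArg Prod.snd hxy) ⟨n⟩
  · exact ⟨fun t ↦ Nat.casesOn t.down z.1 fun n ↦ z.2 ⟨n⟩, rfl⟩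

/-- Direct summands of Gorenstein injective modules are Gorenstein injective, by the Eilenberg
swindle. -/
theorem IsGorensteinInjective.of_prod (h : IsGorensteinInjective R (N × W)) :
    IsGorensteinInjective R N := by
  have hpi : IsGorensteinInjective R (ULift.{u} ℕ → N × W) := IsGorensteinInjective.pi fun _ ↦ h
  let split : (ULift.{u} ℕ → N × W) ≃ₗ[R] (ULift.{u} ℕ → N) × (ULift.{u} ℕ → W) :=
    { toFun := fun x ↦ (fun t ↦ (x t).1, fun t ↦ (x t).2)
      invFun := fun y t ↦ (y.1 t, y.2 t)
      map_add' := fun _ _ ↦ rfl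
      map_smul' := fun _ _ ↦ rfl
      left_inv := fun _ ↦ rfl
      right_inv := fun _ ↦ rfl }
  obtain ⟨e⟩ := nonempty_equiv_prod_sequence R N
  have e' : (ULift.{u} ℕ → N × W) ≃ₗ[R] N × (ULift.{u} ℕ → N × W) :=
    split.trans ((e.prodCongr (LinearEquiv.refl R _)).trans ((LinearEquiv.prodAssoc R _ _ _).trans
      ((LinearEquiv.refl R N).prodCongr split.symm)))
  exact (hpi.of_equiv e').of_prod_of_right hpi

/-- If `A` and `B` are Gorenstein injective then so is the quotient of `B` by `A`. -/
theorem IsGorensteinInjective.quotient (hA : IsGorensteinInjective R A)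
    (hB : IsGorensteinInjective R B) {i : A →ₗ[R] B} {p : B →ₗ[R] C} (h : IsShortExact i p) :
    IsGorensteinInjective R C := by
  obtain ⟨K, I, j, q, hK, hI, hjq⟩ := hA.exists_right
  obtain ⟨P, b, d, pc, px, hd, hb⟩ := h.exists_pushout hjq
  obtain ⟨r, hr⟩ := exists_extension hd.inj (LinearMap.id : I →ₗ[R] I)
  obtain ⟨e⟩ := hd.nonempty_equiv_prod_of_retraction r hr
  exact ((hB.of_extension hK hb).of_equiv (e.trans (LinearEquiv.prodComm R _ _))).of_prod

/-- If `B` is injective, `C` is Gorenstein injective and `Ext¹(J, A)` vanishes for all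
injective `J`, then `A` is Gorenstein injective. -/
theorem IsGorensteinInjective.of_isShortExact (hA : InjectiveExtVanishing R A)
    [Module.Injective R B] (hC : IsGorensteinInjective R C) {i : A →ₗ[R] B} {p : B →ₗ[R] C}
    (h : IsShortExact i p) : IsGorensteinInjective R A := by
  obtain ⟨K, I, j, q, hK, hI, hjq⟩ := hC.exists_left
  obtain ⟨g, hg⟩ := hA I B C i p hI h q
  obtain ⟨t, ht⟩ := exists_lift_of_injective h.inj (-(g ∘ₗ j))
    (fun k ↦ h.exists_of_eq_zero (by simp [hg, hjq.comp_eq_zero]))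
  have hK' : IsShortExact (t.prod j) (i.coprod g) := by
    refine ⟨fun x y hxy ↦ hjq.inj (congrArg Prod.snd hxy), ?_, fun b ↦ ?_⟩
    · rintro ⟨a, e⟩
      refine ⟨fun hae ↦ ?_, ?_⟩
      · have hae' : i a + g e = 0 := by simpa using hae
        have he : q e = 0 := by
          have := congrArg p hae'
          rwa [map_add, h.comp_eq_zero, zero_add, hg, map_zero] at this
        obtain ⟨k, rfl⟩ := hjq.exists_of_eq_zero he
        refine ⟨k, Prod.ext (h.inj ?_) rfl⟩
        simpa [ht, eq_comm] using eq_neg_of_add_eq_zero_left hae'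
      · rintro ⟨k, hk⟩
        rw [← hk]
        simp [ht]
    · obtain ⟨e, he⟩ := hjq.surj (p b)
      obtain ⟨a, ha⟩ := h.exists_of_eq_zero (b := b - g e) (by simp [hg, he])
      exact ⟨(a, e), by simp [ha]⟩
  obtain ⟨σ, hσ⟩ := hK.extVanishing B _ _ _ _ ‹_› hK' LinearMap.id
  obtain ⟨e⟩ := hK'.nonempty_equiv_prod_of_section σ hσ
  exact ((hK.prod IsGorensteinInjective.of_injective).of_equiv e.symm).of_prod

end GorensteinInjective

/-! ## Gorenstein injective dimension -/

section GorensteinInjectiveDimension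

variable {R : Type u} [CommRing R]

theorem exists_injective_embedding (R : Type u) [CommRing R] (N : Type u) [AddCommGroup N]
    [Module R N] : ∃ (I : ModuleCat.{u} R) (i : N →ₗ[R] I),
      Module.Injective R I ∧ Function.Injective i := by
  obtain ⟨⟨I, hI, i, hi⟩⟩ := CategoryTheory.EnoughInjectives.presentation (ModuleCat.of R N)
  exact ⟨I, i.hom, (Module.injective_iff_injective_object R I).2 hI,
    (ModuleCat.mono_iff_injective i).1 hi⟩

variable {A B C N W : Type u} [AddCommGroup A] [Module R A] [AddCommGroup B]
  [Module R B] [AddCommGroup C] [Module R C] [AddCommGroup N] [Module R N] [AddCommGroup W]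
  [Module R W]

theorem gidLE_of_equiv {n : ℕ} (h : gidLE R n N) (e : N ≃ₗ[R] W) : gidLE R n W := by
  cases n with
  | zero => exact IsGorensteinInjective.of_equiv h e
  | succ n =>
    obtain ⟨c, hc⟩ := h
    have hr : LinearMap.range (c.ι ∘ₗ e.symm.toLinearMap) = LinearMap.range c.ι :=
      LinearMap.range_comp_of_range_eq_top _ e.symm.range
    refine ⟨⟨c.J, c.ι ∘ₗ e.symm.toLinearMap, c.ginj, c.inj.comp e.symm.injective⟩, ?_⟩
    change gidLE R n (c.J ⧸ LinearMap.range (c.ι ∘ₗ e.symm.toLinearMap))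
    rwa [hr]

theorem gidLE_succ_of_isShortExact {n : ℕ} {i : A →ₗ[R] B} {p : B →ₗ[R] C}
    (h : IsShortExact i p) (hB : IsGorensteinInjective R B) (hC : gidLE R n C) :
    gidLE R (n + 1) A := by
  obtain ⟨e⟩ := h.nonempty_equiv
  exact ⟨⟨B, i, hB, h.inj⟩, gidLE_of_equiv hC e.symm⟩

theorem exists_isShortExact_of_gidLE_succ {n : ℕ} (h : gidLE R (n + 1) A) :
    ∃ (B C : ModuleCat.{u} R) (i : A →ₗ[R] B) (p : B →ₗ[R] C),
      IsShortExact i p ∧ IsGorensteinInjective R B ∧ gidLE R n C := by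
  obtain ⟨c, hc⟩ := h
  exact ⟨ModuleCat.of R c.J, ModuleCat.of R (c.J ⧸ LinearMap.range c.ι), c.ι, _,
    IsShortExact.of_injective c.inj, c.ginj, hc⟩

theorem gidLE_prod_of_injective {n : ℕ} [Module.Injective R A] (h : gidLE R n N) :
    gidLE R n (A × N) := by
  cases n with
  | zero => exact IsGorensteinInjective.of_injective.prod h
  | succ n =>
    obtain ⟨B, C, i, p, hip, hB, hC⟩ := exists_isShortExact_of_gidLE_succ h
    refine gidLE_succ_of_isShortExact (i := (LinearMap.id : A →ₗ[R] A).prodMap i)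
      (p := p ∘ₗ LinearMap.snd R A B) ⟨?_, ?_, hip.surj.comp LinearMap.snd_surjective⟩
      (IsGorensteinInjective.of_injective.prod hB) hC
    · rintro ⟨x, y⟩ ⟨x', y'⟩ hxy
      simp only [LinearMap.prodMap_apply, LinearMap.id_apply, Prod.mk.injEq] at hxy
      exact Prod.ext hxy.1 (hip.inj hxy.2)
    · rintro ⟨a, b⟩
      refine ⟨fun hb ↦ ?_, ?_⟩
      · obtain ⟨x, rfl⟩ := hip.exists_of_eq_zero (b := b) hb
        exact ⟨(a, x), rfl⟩
      · rintro ⟨x, hx⟩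
        rw [← hx]
        simp [hip.comp_eq_zero]

theorem gidLE_quotient {n : ℕ} {i : A →ₗ[R] B} {p : B →ₗ[R] C} (h : IsShortExact i p)
    (hA : IsGorensteinInjective R A) (hB : gidLE R n B) : gidLE R n C := by
  cases n with
  | zero => exact hA.quotient hB h
  | succ n =>
    obtain ⟨X, Y, j, q, hjq, hX, hY⟩ := exists_isShortExact_of_gidLE_succ hB
    obtain ⟨P, m, c, y, hm, hcy, -⟩ := h.exists_third_iso hjq
    exact gidLE_succ_of_isShortExact hcy (hA.quotient hX hm) hY

/-- The cokernel of any embedding into an injective module has smaller Gorenstein injective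
dimension. -/
theorem gidLE_of_isShortExact_of_injective {n : ℕ} {i : A →ₗ[R] B} {p : B →ₗ[R] C}
    (h : IsShortExact i p) [Module.Injective R B] (hA : gidLE R (n + 1) A) : gidLE R n C := by
  obtain ⟨J, Y, j, q, hjq, hJ, hY⟩ := exists_isShortExact_of_gidLE_succ hA
  obtain ⟨P, b, d, pc, px, hd, hb⟩ := h.exists_pushout hjq
  obtain ⟨r, hr⟩ := exists_extension hb.inj (LinearMap.id : B →ₗ[R] B)
  obtain ⟨e⟩ := hb.nonempty_equiv_prod_of_retraction r hr
  exact gidLE_quotient hd hJ (gidLE_of_equiv (gidLE_prod_of_injective hY) e.symm)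

theorem gidLE_pi {n : ℕ} {ι : Type u} {N : ι → Type u} [∀ t, AddCommGroup (N t)]
    [∀ t, Module R (N t)] (h : ∀ t, gidLE R n (N t)) : gidLE R n (∀ t, N t) := by
  induction n generalizing N with
  | zero => exact IsGorensteinInjective.pi h
  | succ n ih =>
    choose B C i p hip hB hC using fun t ↦ exists_isShortExact_of_gidLE_succ (h t)
    exact gidLE_succ_of_isShortExact (IsShortExact.pi hip) (IsGorensteinInjective.pi hB) (ih hC)

theorem gidLE_of_prod {n : ℕ} (h : gidLE R n (N × W)) : gidLE R n N := by
  induction n generalizing N W with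
  | zero => exact IsGorensteinInjective.of_prod h
  | succ n ih =>
    obtain ⟨I, i, hI, hi⟩ := exists_injective_embedding R N
    obtain ⟨I', i', hI', hi'⟩ := exists_injective_embedding R W
    have hs := IsShortExact.of_injective hi
    have hs' := IsShortExact.of_injective hi'
    have : Module.Injective R (I × I') := injective_prod
    exact gidLE_succ_of_isShortExact hs IsGorensteinInjective.of_injective
      (ih (gidLE_of_isShortExact_of_injective (hs.prod hs') h))

/-- Retracts of a module have at most its Gorenstein injective dimension. -/
theorem gidLE_of_retract {n : ℕ} (h : gidLE R n W) (i : N →ₗ[R] W) (r : W →ₗ[R] N)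
    (hr : ∀ x, r (i x) = x) : gidLE R n N := by
  have hi : Function.Injective i := Function.LeftInverse.injective hr
  obtain ⟨e⟩ := (IsShortExact.of_injective hi).nonempty_equiv_prod_of_retraction r hr
  exact gidLE_of_prod (gidLE_of_equiv h e)

end GorensteinInjectiveDimension

/-! ## Character modules -/

section Characters

variable {R : Type u} [CommRing R] {A B C J M : Type u} [AddCommGroup A] [Module R A]
  [AddCommGroup B] [Module R B] [AddCommGroup C] [Module R C] [AddCommGroup J] [Module R J]
  [AddCommGroup M] [Module R M]

open scoped TensorProduct

/-- The biduality map of a module into its double character module. -/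
def characterEval (R : Type u) [CommRing R] (M : Type u) [AddCommGroup M] [Module R M] :
    M →ₗ[R] CharacterModule (CharacterModule M) where
  toFun m := AddMonoidHom.mk' (fun c : CharacterModule M ↦ c m) fun _ _ ↦ rfl
  map_add' x y := CharacterModule.ext _ fun c : CharacterModule M ↦ map_add c x y
  map_smul' _ _ := rfl

theorem exists_character_desc {p : B →ₗ[R] C} (hp : Function.Surjective p) (χ : CharacterModule B)
    (h : ∀ b, p b = 0 → χ b = 0) : ∃ ξ : CharacterModule C, ∀ b, ξ (p b) = χ b := by
  let ξ := p.toAddMonoidHom.liftOfSurjective hp ⟨(χ : B →+ AddCircle (1 : ℚ)), h⟩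
  exact ⟨ξ, fun b ↦ AddMonoidHom.liftOfRightInverse_comp_apply _ _ _ _ b⟩

theorem exists_character_extension {i : A →ₗ[R] B} (hi : Function.Injective i)
    (χ : CharacterModule A) : ∃ ξ : CharacterModule B, ∀ a, ξ (i a) = χ a := by
  obtain ⟨ξ, hξ⟩ := CharacterModule.dual_surjective_of_injective i hi χ
  exact ⟨ξ, fun a ↦ DFunLike.congr_fun hξ a⟩

/-- A character vanishing on the kernel of a linear map factors through it. -/
theorem exists_character_factor (f : A →ₗ[R] B) (χ : CharacterModule A)
    (h : ∀ a, f a = 0 → χ a = 0) : ∃ ξ : CharacterModule B, ∀ a, ξ (f a) = χ a := by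
  obtain ⟨ξ, hξ⟩ := exists_character_desc f.surjective_rangeRestrict χ
    fun a ha ↦ h a (congrArg Subtype.val ha)
  obtain ⟨ζ, hζ⟩ := exists_character_extension (LinearMap.range f).injective_subtype ξ
  exact ⟨ζ, fun a ↦ (hζ (f.rangeRestrict a)).trans (hξ a)⟩

theorem IsShortExact.dual {i : A →ₗ[R] B} {p : B →ₗ[R] C} (h : IsShortExact i p) :
    IsShortExact (CharacterModule.dual p) (CharacterModule.dual i) := by
  refine ⟨CharacterModule.dual_injective_of_surjective p h.surj, fun χ ↦ ⟨fun hχ ↦ ?_, ?_⟩,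
    CharacterModule.dual_surjective_of_injective i h.inj⟩
  · obtain ⟨ξ, hξ⟩ := exists_character_desc h.surj χ (by
      intro b hb
      obtain ⟨a, rfl⟩ := h.exists_of_eq_zero hb
      exact DFunLike.congr_fun hχ a)
    exact ⟨ξ, CharacterModule.ext _ hξ⟩
  · rintro ⟨ξ, rfl⟩
    refine CharacterModule.ext _ fun a ↦ ?_
    change ξ (p (i a)) = 0
    rw [h.comp_eq_zero, map_zero]

theorem lTensor_injective_iff_exists_lift {i : A →ₗ[R] B} :
    Function.Injective (i.lTensor J) ↔ ∀ φ : J →ₗ[R] CharacterModule A,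
      ∃ ψ : J →ₗ[R] CharacterModule B, ∀ x, CharacterModule.dual i (ψ x) = φ x := by
  have key : ∀ ψ : J →ₗ[R] CharacterModule B,
      CharacterModule.dual (i.lTensor J) (CharacterModule.homEquiv ψ) =
        CharacterModule.homEquiv (CharacterModule.dual i ∘ₗ ψ) := by
    intro ψ
    refine CharacterModule.ext _ fun z ↦ ?_
    induction z with
    | zero => simp only [map_zero]
    | add x y hx hy => rw [map_add, map_add, hx, hy]
    | tmul x y => rfl
  rw [← CharacterModule.dual_surjective_iff_injective]
  refine ⟨fun h φ ↦ ?_, fun h χ ↦ ?_⟩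
  · obtain ⟨ξ, hξ⟩ := h (CharacterModule.homEquiv φ)
    obtain ⟨ψ, rfl⟩ := CharacterModule.homEquiv.surjective ξ
    rw [key] at hξ
    exact ⟨ψ, fun x ↦ LinearMap.congr_fun (CharacterModule.homEquiv.injective hξ) x⟩
  · obtain ⟨φ, rfl⟩ := CharacterModule.homEquiv.surjective χ
    obtain ⟨ψ, hψ⟩ := h φ
    exact ⟨CharacterModule.homEquiv ψ, (key ψ).trans (congrArg _ (LinearMap.ext hψ))⟩

theorem injective_characterModule_of_flat [Module.Flat R M] :
    Module.Injective R (CharacterModule M) :=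
  Module.Flat.iff_characterModule_injective.1 ‹_›

/-- Over a noetherian ring, products of copies of the character module of an injective module
are flat. -/
theorem flat_pi_characterModule [IsNoetherianRing R] [Module.Injective R J] (T : Type u) :
    Module.Flat R (T → CharacterModule J) := by
  refine Module.Flat.of_forall_isTrivialRelation fun {l f x} hfx ↦ ?_
  let F : (Fin l → R) →ₗ[R] R := Fintype.linearCombination R f
  have hF : ∀ v, F v = ∑ i, v i * f i := fun v ↦ rfl
  obtain ⟨k, a, ha⟩ := Submodule.fg_iff_exists_fin_generating_family.1
    (IsNoetherian.noetherian (LinearMap.ker F))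
  let α : (Fin l → J) →ₗ[R] (Fin k → J) :=
    LinearMap.pi fun j ↦ ∑ i, a j i • LinearMap.proj i
  have hα : ∀ v j, α v j = ∑ i, a j i • v i := fun v j ↦ by simp [α]
  have hker : ∀ v, α v = 0 → ∃ e : J, ∀ i, v i = f i • e := by
    intro v hv
    let V : (Fin l → R) →ₗ[R] J := Fintype.linearCombination R v
    obtain ⟨g, hg⟩ := exists_desc_of_surjective F.surjective_rangeRestrict V (by
      intro w hw
      have hw' : w ∈ LinearMap.ker F := congrArg Subtype.val hw
      have hle : LinearMap.ker F ≤ LinearMap.ker V := by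
        rw [← ha, Submodule.span_le]
        rintro _ ⟨j, rfl⟩
        exact (hα v j).symm.trans (congrFun hv j)
      exact hle hw')
    obtain ⟨g', hg'⟩ := exists_extension (LinearMap.range F).injective_subtype g
    refine ⟨g' 1, fun i ↦ ?_⟩
    have h1 : V (Pi.single i 1) = v i := by simp [V]
    have h2 : F (Pi.single i 1) = f i := by simp [F]
    rw [← h1, ← hg, ← hg', ← map_smul]
    exact congrArg g' (by simpa using h2)
  have hx : ∀ t, ∃ ξ : CharacterModule (Fin k → J), ∀ v, ξ (α v) = ∑ i, x i t (v i) := by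
    intro t
    let χ : CharacterModule (Fin l → J) :=
      ∑ i, CharacterModule.dual (LinearMap.proj i : (Fin l → J) →ₗ[R] J) (x i t)
    have hχ : ∀ v, χ v = ∑ i, x i t (v i) := fun v ↦
      (AddMonoidHom.finsetSum_apply _ _ _).trans rfl
    obtain ⟨ξ, hξ⟩ := exists_character_factor α χ (by
      intro v hv
      obtain ⟨e, he⟩ := hker v hv
      rw [hχ]
      have := DFunLike.congr_fun (congrFun hfx t) e
      rw [Finset.sum_apply] at this
      simp only [he]
      exact (AddMonoidHom.finsetSum_apply _ _ _).symm.trans this)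
    exact ⟨ξ, fun v ↦ (hξ v).trans (hχ v)⟩
  choose ξ hξ using hx
  refine ⟨k, fun i j ↦ a j i,
    fun j t ↦ CharacterModule.dual (LinearMap.single R (fun _ ↦ J) j) (ξ t), fun i ↦ ?_,
    fun j ↦ ?_⟩
  · funext t
    refine CharacterModule.ext _ fun e ↦ ?_
    have h1 : x i t e = ξ t (α (Pi.single i e)) := by
      rw [hξ, Finset.sum_eq_single i]
      · simp
      · intro j _ hj
        simp [Pi.single_eq_of_ne hj]
      · simp
    have h2 : α (Pi.single i e) = ∑ j, Pi.single j (a j i • e) := by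
      rw [Finset.univ_sum_single]
      funext j
      rw [hα, Finset.sum_eq_single i]
      · simp
      · intro i' _ hi
        simp [Pi.single_eq_of_ne hi]
      · simp
    rw [h1, h2, map_sum, Finset.sum_apply]
    refine Eq.trans ?_ (AddMonoidHom.finsetSum_apply _ _ _).symm
    rfl
  · have : a j ∈ LinearMap.ker F := ha ▸ Submodule.subset_span ⟨j, rfl⟩
    have h0 := hF (a j) ▸ LinearMap.mem_ker.1 this
    simpa [mul_comm] using h0

/-- An injective module containing a copy of every finitely generated module. -/
theorem exists_injective_of_finite_embedding (R : Type u) [CommRing R] :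
    ∃ J : ModuleCat.{u} R, Module.Injective R J ∧ ∀ (N : Type u) [AddCommGroup N] [Module R N],
      Module.Finite R N → ∃ f : N →ₗ[R] J, Function.Injective f := by
  obtain ⟨J, i, hJ, hi⟩ := exists_injective_embedding R
    (∀ t : Σ n : ℕ, Submodule R (Fin n → R), (Fin t.1 → R) ⧸ t.2)
  classical
  refine ⟨J, hJ, fun N _ _ hN ↦ ?_⟩
  obtain ⟨n, f, hf⟩ := Module.Finite.exists_fin' R N
  let e := f.quotKerEquivOfSurjective hf
  let s := LinearMap.single R
    (fun t : Σ n : ℕ, Submodule R (Fin n → R) ↦ (Fin t.1 → R) ⧸ t.2) ⟨n, LinearMap.ker f⟩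
  exact ⟨i ∘ₗ s ∘ₗ e.symm.toLinearMap, hi.comp ((Pi.single_injective _).comp e.symm.injective)⟩

/-- Over a noetherian ring, every module has a map to a flat module which stays injective after
tensoring with an injective module. -/
theorem exists_flat_lTensor_injective [IsNoetherianRing R] (M : Type u) [AddCommGroup M]
    [Module R M] : ∃ (F : ModuleCat.{u} R) (i : M →ₗ[R] F), Module.Flat R F ∧
      ∀ (I : Type u) [AddCommGroup I] [Module R I], Module.Injective R I →
        Function.Injective (i.lTensor I) := by
  obtain ⟨J, hJ, hfin⟩ := exists_injective_of_finite_embedding R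
  let T := M →ₗ[R] CharacterModule J
  let i : M →ₗ[R] (T → CharacterModule J) := LinearMap.pi fun t ↦ t
  refine ⟨ModuleCat.of R (T → CharacterModule J), i, flat_pi_characterModule T, ?_⟩
  have hiJ : Function.Injective (i.lTensor J) := by
    rw [lTensor_injective_iff_exists_lift]
    intro φ
    let t : T := CharacterModule.dual φ ∘ₗ characterEval R M
    exact ⟨CharacterModule.dual (LinearMap.proj t) ∘ₗ characterEval R J, fun x ↦ rfl⟩
  intro I _ _ hI
  rw [injective_iff_map_eq_zero]
  intro x hx
  obtain ⟨I₀, hI₀, hxI₀⟩ := TensorProduct.exists_finite_submodule_left_of_setFinite {x}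
    (Set.finite_singleton x)
  obtain ⟨x₀, hx₀⟩ := hxI₀ rfl
  obtain ⟨e, he⟩ := hfin I₀ hI₀
  obtain ⟨α, hα⟩ := exists_extension I₀.injective_subtype e
  obtain ⟨β, hβ⟩ := exists_extension he I₀.subtype
  have hαx : α.rTensor M x = 0 := by
    refine hiJ ?_
    rw [map_zero, ← LinearMap.comp_apply, LinearMap.lTensor_comp_rTensor,
      ← LinearMap.rTensor_comp_lTensor, LinearMap.comp_apply, hx, map_zero]
  have h1 : (β ∘ₗ α) ∘ₗ I₀.subtype = I₀.subtype := LinearMap.ext fun y ↦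
    (congrArg β (hα y)).trans (hβ y)
  have h2 : (β ∘ₗ α).rTensor M x = x := by
    rw [← hx₀, ← LinearMap.comp_apply, ← LinearMap.rTensor_comp, h1]
  rw [← h2, LinearMap.rTensor_comp, LinearMap.comp_apply, hαx, map_zero]

end Characters

/-! ## Gorenstein flat modules -/

section GorensteinFlat

variable {R : Type u} [CommRing R]

/-- There is an exact sequence `0 → A → F → B → 0` with `F` flat which stays exact after
tensoring with an injective module. -/
def FlatStep (A B : ModuleCat.{u} R) : Prop :=
  ∃ (F : ModuleCat.{u} R) (i : A →ₗ[R] F) (p : F →ₗ[R] B), Module.Flat R F ∧ IsShortExact i p ∧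
    ∀ (J : Type u) [AddCommGroup J] [Module R J], Module.Injective R J →
      Function.Injective (i.lTensor J)

/-- A class of modules closed under some choice of syzygies and cosyzygies along flat modules. -/
structure IsGorensteinFlatClass (P : ModuleCat.{u} R → Prop) : Prop where
  left : ∀ M, P M → ∃ M', P M' ∧ FlatStep M' M
  right : ∀ M, P M → ∃ M', P M' ∧ FlatStep M M'

theorem IsGorensteinFlatClass.isGorensteinFlat {P : ModuleCat.{u} R → Prop}
    (hP : IsGorensteinFlatClass P) {M : Type u} [AddCommGroup M] [Module R M]
    (hM : P (ModuleCat.of R M)) : IsGorensteinFlat R M := by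
  obtain ⟨z, hz1, hz⟩ := exists_int_chain (r := FlatStep) hP.left hP.right hM
  choose F i p hF hip hJ using hz
  refine ⟨{ F := fun k ↦ F k
            d := fun k ↦ i k ∘ₗ p (k + 1)
            flat := hF
            exact := fun k x ↦ ?_
            exact_tensor := fun J _ _ hJinj k x ↦ ?_
            iso := ?_ }⟩
  · refine ⟨fun hx ↦ ?_, ?_⟩
    · have : p (k + 1) x = 0 := (hip k).inj (by simpa using hx)
      obtain ⟨y, rfl⟩ := (hip (k + 1)).exists_of_eq_zero this
      obtain ⟨w, rfl⟩ := (hip (k + 1 + 1)).surj y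
      exact ⟨w, rfl⟩
    · rintro ⟨w, rfl⟩
      simp [(hip (k + 1)).comp_eq_zero]
  · have hex := lTensor_exact J (hip (k + 1)).exact (hip (k + 1)).surj
    rw [LinearMap.lTensor_comp, LinearMap.lTensor_comp]
    refine ⟨fun hx ↦ ?_, ?_⟩
    · have : (p (k + 1)).lTensor J x = 0 := hJ k J hJinj (by simpa using hx)
      obtain ⟨y, rfl⟩ := (hex x).1 this
      obtain ⟨w, rfl⟩ := LinearMap.lTensor_surjective J (hip (k + 1 + 1)).surj y
      exact ⟨w, rfl⟩
    · rintro ⟨w, rfl⟩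
      simp only [LinearMap.comp_apply]
      rw [hex.apply_apply_eq_zero, map_zero]
  · have hr : LinearMap.range (i 0 ∘ₗ p (0 + 1)) = LinearMap.range (i 0) :=
      LinearMap.range_comp_of_range_eq_top _ (LinearMap.range_eq_top.2 (hip _).surj)
    have e : z (0 + 1) ≃ₗ[R] M := (CategoryTheory.eqToIso hz1).toLinearEquiv
    exact ⟨e.symm.trans ((LinearEquiv.ofInjective _ (hip 0).inj).trans
      (LinearEquiv.ofEq _ _ hr.symm))⟩

attribute [local instance] GorensteinFlatWitness.instAdd GorensteinFlatWitness.instMod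

theorem GorensteinFlatWitness.isShortExact {Q : Type u} [AddCommGroup Q] [Module R Q]
    (w : GorensteinFlatWitness R Q) (k : ℤ) :
    IsShortExact (LinearMap.range (w.d (k + 1))).subtype (w.d k).rangeRestrict :=
  ⟨Subtype.val_injective, fun x ↦ by
    rw [← LinearMap.mem_ker, LinearMap.ker_rangeRestrict, LinearMap.mem_ker, w.exact k x]
    simp, LinearMap.surjective_rangeRestrict _⟩

theorem GorensteinFlatWitness.lTensor_injective {Q : Type u} [AddCommGroup Q] [Module R Q]
    (w : GorensteinFlatWitness R Q) (k : ℤ) (J : Type u) [AddCommGroup J] [Module R J]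
    (hJ : Module.Injective R J) :
    Function.Injective ((LinearMap.range (w.d k)).subtype.lTensor J) := by
  rw [injective_iff_map_eq_zero]
  intro y hy
  obtain ⟨v, rfl⟩ := LinearMap.lTensor_surjective J (w.d k).surjective_rangeRestrict y
  rw [← LinearMap.comp_apply, ← LinearMap.lTensor_comp] at hy
  obtain ⟨x, rfl⟩ := (w.exact_tensor J hJ k v).1 hy
  have h0 : (w.d k).rangeRestrict ∘ₗ w.d (k + 1) = 0 :=
    LinearMap.ext fun u ↦ Subtype.ext ((w.exact k).apply_apply_eq_zero u)
  rw [← LinearMap.comp_apply, ← LinearMap.lTensor_comp, h0, LinearMap.lTensor_zero,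
    LinearMap.zero_apply]

theorem exists_class_of_isGorensteinFlat {M : Type u} [AddCommGroup M] [Module R M]
    (h : IsGorensteinFlat R M) :
    ∃ P : ModuleCat.{u} R → Prop, IsGorensteinFlatClass P ∧ P (ModuleCat.of R M) := by
  obtain ⟨w⟩ := h
  refine ⟨fun X ↦ ∃ k, Nonempty (X ≃ₗ[R] LinearMap.range (w.d k)), ⟨?_, ?_⟩, 0, w.iso⟩
  · rintro X ⟨k, ⟨e⟩⟩
    exact ⟨ModuleCat.of R (LinearMap.range (w.d (k + 1))), ⟨k + 1, ⟨LinearEquiv.refl _ _⟩⟩,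
      ModuleCat.of R (w.F (k + 1)), _, _, w.flat _, (w.isShortExact k).congr_right e.symm,
      w.lTensor_injective (k + 1)⟩
  · rintro X ⟨k, ⟨e⟩⟩
    obtain ⟨k, rfl⟩ : ∃ l, k = l + 1 := ⟨k - 1, by ring⟩
    refine ⟨ModuleCat.of R (LinearMap.range (w.d k)), ⟨k, ⟨LinearEquiv.refl _ _⟩⟩,
      ModuleCat.of R (w.F (k + 1)), _, _, w.flat _, (w.isShortExact k).congr_left e, ?_⟩
    intro J _ _ hJ
    rw [LinearMap.lTensor_comp]
    exact (w.lTensor_injective (k + 1) J hJ).comp (e.lTensor J).injective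

variable {A B C M : Type u} [AddCommGroup A] [Module R A] [AddCommGroup B] [Module R B]
  [AddCommGroup C] [Module R C] [AddCommGroup M] [Module R M]

theorem injectiveExtVanishing_characterModule_iff {i : A →ₗ[R] B} {p : B →ₗ[R] C}
    (h : IsShortExact i p) [Module.Flat R B] :
    InjectiveExtVanishing R (CharacterModule C) ↔ ∀ (J : Type u) [AddCommGroup J] [Module R J],
      Module.Injective R J → Function.Injective (i.lTensor J) := by
  have : Module.Injective R (CharacterModule B) := injective_characterModule_of_flat
  refine ⟨fun hC J _ _ hJ ↦ ?_, fun hi ↦ ?_⟩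
  · rw [lTensor_injective_iff_exists_lift]
    exact fun φ ↦ hC J _ _ _ _ hJ h.dual φ
  · exact InjectiveExtVanishing.of_isShortExact h.dual fun J _ _ hJ φ ↦
      lTensor_injective_iff_exists_lift.1 (hi J hJ) φ

theorem IsGorensteinFlat.characterModule (h : IsGorensteinFlat R M) :
    IsGorensteinInjective R (CharacterModule M) := by
  obtain ⟨P, hP, hPM⟩ := exists_class_of_isGorensteinFlat h
  have hclass : IsGorensteinInjectiveClass fun X : ModuleCat.{u} R ↦
      ∃ Q : ModuleCat.{u} R, P Q ∧ X = ModuleCat.of R (CharacterModule Q) := by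
    refine ⟨?_, ?_, ?_⟩
    · rintro _ ⟨Q, hQ, rfl⟩
      obtain ⟨Q', -, F, i, p, hF, hip, hi⟩ := hP.left Q hQ
      exact (injectiveExtVanishing_characterModule_iff hip).2 hi
    · rintro _ ⟨Q, hQ, rfl⟩
      obtain ⟨Q', hQ', F, i, p, hF, hip, -⟩ := hP.right Q hQ
      exact ⟨ModuleCat.of R (CharacterModule Q'), ⟨Q', hQ', rfl⟩,
        ModuleCat.of R (CharacterModule F), _, _, injective_characterModule_of_flat, hip.dual⟩
    · rintro _ ⟨Q, hQ, rfl⟩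
      obtain ⟨Q', hQ', F, i, p, hF, hip, -⟩ := hP.left Q hQ
      exact ⟨ModuleCat.of R (CharacterModule Q'), ⟨Q', hQ', rfl⟩,
        ModuleCat.of R (CharacterModule F), _, _, injective_characterModule_of_flat, hip.dual⟩
  exact hclass.isGorensteinInjective ⟨ModuleCat.of R M, hPM, rfl⟩

theorem exists_flat_isShortExact (R : Type u) [CommRing R] (M : Type u) [AddCommGroup M]
    [Module R M] : ∃ (F : ModuleCat.{u} R) (p : F →ₗ[R] M), Module.Flat R F ∧
      IsShortExact (LinearMap.ker p).subtype p :=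
  ⟨ModuleCat.of R (M →₀ R), Finsupp.linearCombination R id,
    inferInstanceAs (Module.Flat R (M →₀ R)),
    IsShortExact.of_surjective (Finsupp.linearCombination_id_surjective R M)⟩

theorem isGorensteinFlat_of_characterModule [IsNoetherianRing R]
    (h : IsGorensteinInjective R (CharacterModule M)) : IsGorensteinFlat R M := by
  have hclass : IsGorensteinFlatClass fun X : ModuleCat.{u} R ↦
      IsGorensteinInjective R (CharacterModule X) := by
    refine ⟨fun X hX ↦ ?_, fun X hX ↦ ?_⟩
    · obtain ⟨F, p, hF, hp⟩ := exists_flat_isShortExact R X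
      have : Module.Injective R (CharacterModule F) := injective_characterModule_of_flat
      exact ⟨ModuleCat.of R (LinearMap.ker p),
        hX.quotient IsGorensteinInjective.of_injective hp.dual, F, _, p, hF, hp,
        (injectiveExtVanishing_characterModule_iff hp).1 hX.extVanishing⟩
    · obtain ⟨F, i, hF, hi⟩ := exists_flat_lTensor_injective (R := R) X
      have hinj : Function.Injective i := by
        rw [injective_iff_map_eq_zero]
        intro x hx
        obtain ⟨K, I, k, φ, hK, hI, hkφ⟩ := hX.exists_left
        refine CharacterModule.eq_zero_of_character_apply fun c ↦ ?_
        obtain ⟨y, rfl⟩ := hkφ.surj c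
        obtain ⟨ψ, hψ⟩ := lTensor_injective_iff_exists_lift.1 (hi I hI) φ
        rw [← hψ]
        change ψ y (i x) = 0
        rw [hx, map_zero]
      have hs := IsShortExact.of_injective hinj
      have : Module.Injective R (CharacterModule F) := injective_characterModule_of_flat
      exact ⟨ModuleCat.of R (F ⧸ LinearMap.range i), IsGorensteinInjective.of_isShortExact
        ((injectiveExtVanishing_characterModule_iff hs).2 hi) hX hs.dual, F, i, _, hF, hs, hi⟩
  exact hclass.isGorensteinFlat h

theorem gfdLE_iff_gidLE_characterModule [IsNoetherianRing R] {n : ℕ} :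
    gfdLE R n M ↔ gidLE R n (CharacterModule M) := by
  induction n generalizing M with
  | zero => exact ⟨IsGorensteinFlat.characterModule, isGorensteinFlat_of_characterModule⟩
  | succ n ih =>
    refine ⟨?_, fun h ↦ ?_⟩
    · rintro ⟨c, hc⟩
      exact gidLE_succ_of_isShortExact (IsShortExact.of_surjective c.surj).dual
        c.gflat.characterModule (ih.1 hc)
    · obtain ⟨F, p, hF, hp⟩ := exists_flat_isShortExact R M
      have : Module.Injective R (CharacterModule F) := injective_characterModule_of_flat
      exact ⟨⟨F, p, isGorensteinFlat_of_characterModule IsGorensteinInjective.of_injective,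
        hp.surj⟩, ih.2 (gidLE_of_isShortExact_of_injective hp.dual h)⟩

end GorensteinFlat

/-! ## Matlis duals and character modules -/

section MatlisDual

variable {S : Type u} [CommRing S]

/-- Maps into the injective envelope of the residue field separate points. -/
theorem IsInjEnvResidueField.exists_apply_ne_zero [IsLocalRing S] {E : Type u} [AddCommGroup E]
    [Module S E] (hE : IsInjEnvResidueField S E) {N : Type u} [AddCommGroup N] [Module S N] {x : N}
    (hx : x ≠ 0) : ∃ φ : N →ₗ[S] E, φ x ≠ 0 := by
  obtain ⟨hinj, ι, hι, -⟩ := hE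
  let t := LinearMap.toSpanSingleton S N x
  let g : S →ₗ[S] E := ι ∘ₗ Algebra.linearMap S (ResidueField S)
  obtain ⟨k, hk⟩ := exists_desc_of_surjective t.surjective_rangeRestrict g (by
    intro s hs
    have hsx : s • x = 0 := congrArg Subtype.val hs
    have hs' : s ∈ maximalIdeal S := fun hu ↦ hx ((hu.smul_eq_zero).1 hsx)
    have h0 : algebraMap S (ResidueField S) s = 0 := (residue_eq_zero_iff s).2 hs'
    change ι (algebraMap S (ResidueField S) s) = 0
    rw [h0, map_zero])
  obtain ⟨φ, hφ⟩ := exists_extension (LinearMap.range t).injective_subtype k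
  refine ⟨φ, fun h ↦ ?_⟩
  have h1 : φ (t 1) = g 1 := (hφ (t.rangeRestrict 1)).trans (hk 1)
  have h2 : t 1 = x := by simp [t]
  rw [h2, h] at h1
  have h3 : algebraMap S (ResidueField S) 1 = 0 := hι (h1.symm.trans (map_zero ι).symm)
  exact one_ne_zero ((map_one _).symm.trans h3)

/-- `Hom_S(M, S⁺)` is isomorphic to the character module of `M`. -/
noncomputable def homCharacterModuleEquiv (S : Type u) [CommRing S] (M : Type u) [AddCommGroup M]
    [Module S M] : (M →ₗ[S] CharacterModule S) ≃ₗ[S] CharacterModule M :=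
  CharacterModule.homEquiv.trans (CharacterModule.congr (TensorProduct.rid S M))

theorem exists_apply_ne_zero_characterModule {N : Type u} [AddCommGroup N] [Module S N] {x : N}
    (hx : x ≠ 0) : ∃ φ : N →ₗ[S] CharacterModule S, φ x ≠ 0 := by
  obtain ⟨c, hc⟩ := CharacterModule.exists_character_apply_ne_zero_of_ne_zero hx
  obtain ⟨φ, rfl⟩ := (homCharacterModuleEquiv S N).surjective c
  refine ⟨φ, fun h ↦ hc ?_⟩
  have : homCharacterModuleEquiv S N φ x = φ x 1 := rfl
  rw [this, h]
  rfl

variable {R : Type u} [CommRing R] [Algebra R S] {M D D' : Type u} [AddCommGroup M] [Module S M]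
  [AddCommGroup D] [Module S D] [AddCommGroup D'] [Module S D']

/-- If `D` is injective and maps from `D` to `D'` separate points, then `Hom(M, D)` has at most
the Gorenstein injective dimension of `Hom(M, D')`. -/
theorem gidLE_hom_of_separating [Module R (M →ₗ[S] D)] [IsScalarTower R S (M →ₗ[S] D)]
    [Module R (M →ₗ[S] D')] [IsScalarTower R S (M →ₗ[S] D')] [Module.Injective S D]
    (hsep : ∀ x : D, x ≠ 0 → ∃ φ : D →ₗ[S] D', φ x ≠ 0) {n : ℕ} (h : gidLE R n (M →ₗ[S] D')) :
    gidLE R n (M →ₗ[S] D) := by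
  let i : D →ₗ[S] ((D →ₗ[S] D') → D') := LinearMap.pi fun φ ↦ φ
  have hi : Function.Injective i := by
    rw [injective_iff_map_eq_zero]
    intro x hx
    by_contra hx0
    obtain ⟨φ, hφ⟩ := hsep x hx0
    exact hφ (congrFun hx φ)
  obtain ⟨r, hr⟩ := exists_extension hi (LinearMap.id : D →ₗ[S] D)
  let I : (M →ₗ[S] D) →ₗ[S] ((D →ₗ[S] D') → (M →ₗ[S] D')) :=
    LinearMap.pi fun φ ↦ LinearMap.llcomp S M D D' φ
  let ρ : ((D →ₗ[S] D') → (M →ₗ[S] D')) →ₗ[S] (M →ₗ[S] D) :=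
    { toFun := fun ψ ↦ r ∘ₗ LinearMap.pi ψ
      map_add' := fun x y ↦ LinearMap.ext fun m ↦ map_add r (fun t ↦ x t m) (fun t ↦ y t m)
      map_smul' := fun s x ↦ LinearMap.ext fun m ↦ map_smul r s (fun t ↦ x t m) }
  exact gidLE_of_retract (gidLE_pi fun _ ↦ h) (I.restrictScalars R) (ρ.restrictScalars R)
    fun φ ↦ LinearMap.ext fun m ↦ hr (φ m)

theorem gidLE_hom_iff_characterModule [IsLocalRing S] [Module R M] [IsScalarTower R S M]
    {E : Type u} [AddCommGroup E] [Module S E] (hE : IsInjEnvResidueField S E)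
    [Module R (M →ₗ[S] E)] [IsScalarTower R S (M →ₗ[S] E)] {n : ℕ} :
    gidLE R n (M →ₗ[S] E) ↔ gidLE R n (CharacterModule M) := by
  let : Module R (M →ₗ[S] CharacterModule S) := Module.compHom _ (algebraMap R S)
  have : IsScalarTower R S (M →ₗ[S] CharacterModule S) :=
    IsScalarTower.of_algebraMap_smul fun _ _ ↦ rfl
  have : IsScalarTower R S (CharacterModule M) := IsScalarTower.of_algebraMap_smul fun r c ↦
    CharacterModule.ext _ fun m ↦ congrArg c (algebraMap_smul S r m)
  have : Module.Injective S (CharacterModule S) := injective_characterModule_of_flat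
  have := hE.1
  let e : (M →ₗ[S] CharacterModule S) ≃ₗ[R] CharacterModule M :=
    (homCharacterModuleEquiv S M).restrictScalars R
  constructor
  · intro h
    exact gidLE_of_equiv (gidLE_hom_of_separating (fun x hx ↦ hE.exists_apply_ne_zero hx) h) e
  · intro h
    exact gidLE_hom_of_separating (fun x hx ↦ exists_apply_ne_zero_characterModule hx)
      (gidLE_of_equiv h e.symm)

end MatlisDual

/-- If `f : (R,m,k) → (S,n,l)` is a local homomorphism of noetherian local rings, `M` is an
`S`-module, and `M^∨ = Hom_S(M, E_S(l))`, and either `R` has a dualizing complex or `M` is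
artinian over `S`, then `Gfd_R M = Gid_R (M^∨)`. -/
theorem gfd_eq_gid_dual {R S : Type u} [CommRing R] [CommRing S]
    [IsLocalRing R] [IsLocalRing S] [IsNoetherianRing R] [IsNoetherianRing S]
    (f : R →+* S) (hloc : IsLocalHom f)
    (M : Type u) [AddCommGroup M] [Module S M]
    (E : Type u) [AddCommGroup E] [Module S E] (hE : IsInjEnvResidueField S E)
    (h : HasDualizingComplex R ∨ IsArtinian S M) :
    gfdAlong f M = gidAlong f (M →ₗ[S] E) := by
  let := f.toAlgebra
  let : Module R M := Module.compHom M f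
  let : Module R (M →ₗ[S] E) := Module.compHom (M →ₗ[S] E) f
  have : IsScalarTower R S M := IsScalarTower.of_algebraMap_smul fun _ _ ↦ rfl
  have : IsScalarTower R S (M →ₗ[S] E) := IsScalarTower.of_algebraMap_smul fun _ _ ↦ rfl
  have key : {n : ℕ | gfdLE R n M} = {n : ℕ | gidLE R n (M →ₗ[S] E)} :=
    Set.ext fun n ↦ gfdLE_iff_gidLE_characterModule.trans (gidLE_hom_iff_characterModule hE).symm
  change sInf ((fun n : ℕ ↦ (n : ℕ∞)) '' {n : ℕ | gfdLE R n M}) =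
    sInf ((fun n : ℕ ↦ (n : ℕ∞)) '' {n : ℕ | gidLE R n (M →ₗ[S] E)})
  rw [key]
end
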